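/- arXiv:1302.4887 — 9 statements merged into one kernel-verified Lean document; each statement's English description precedes it below -/
import Mathlib

section
/- For all indices i, j ≥ 0: if Ŝ_i < T̂_j then i ≤ j, and if Ŝ_i > T̂_j then i ≥ j. -/
open Filter Set

/-- If `R` dominates `u` and `v`, and every later term of `u` exceeds the preceding `R`, then
every term of `v` lies strictly below all terms of `u` with larger index. -/
lemma lt_of_index_lt_of_interlaced {R u v : ℕ → ℝ} (hu : ∀ k, u k ≤ R k) (hv : ∀ k, v k ≤ R k)
    (hlt : ∀ k, R k < u (k + 1)) {i j : ℕ} (hji : j < i) : v j < u i := by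
  have hmono : Monotone R := monotone_nat_of_le_succ fun k => (hlt k).le.trans (hu (k + 1))
  obtain ⟨k, rfl⟩ := Nat.exists_eq_add_of_lt hji
  exact ((hv j).trans (hmono (Nat.le_add_right j k))).trans_lt (hlt (j + k))

/-- For all indices `i, j ≥ 0`: if `Ŝ i < T̂ j` then `i ≤ j`, and if
`Ŝ i > T̂ j` then `i ≥ j`, for the next-tick interpolated sampling times `Ŝ`, `T̂`
associated with the refresh times `R` of the sequences `S` and `T`. -/
theorem stmt1 (S T R Sh Th : ℕ → ℝ)
    (hS : StrictMono S) (hT : StrictMono T)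
    (hSnn : ∀ i, 0 ≤ S i) (hTnn : ∀ j, 0 ≤ T j)
    (hSlim : Tendsto S atTop atTop) (hTlim : Tendsto T atTop atTop)
    (hR0 : R 0 = max (S 0) (T 0))
    (hSh0 : Sh 0 = S 0) (hTh0 : Th 0 = T 0)
    (hSh : ∀ k : ℕ, IsLeast {x | (∃ i, x = S i) ∧ R k < x} (Sh (k + 1)))
    (hTh : ∀ k : ℕ, IsLeast {x | (∃ j, x = T j) ∧ R k < x} (Th (k + 1)))
    (hR : ∀ k : ℕ, R (k + 1) = max (Sh (k + 1)) (Th (k + 1))) :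
    ∀ i j : ℕ, (Sh i < Th j → i ≤ j) ∧ (Th j < Sh i → j ≤ i) := by
  have hRmax : ∀ k, R k = max (Sh k) (Th k) := by
    rintro (_ | k)
    · rw [hR0, hSh0, hTh0]
    · exact hR k
  have hShR : ∀ k, Sh k ≤ R k := fun k => (hRmax k).symm ▸ le_max_left _ _
  have hThR : ∀ k, Th k ≤ R k := fun k => (hRmax k).symm ▸ le_max_right _ _
  refine fun i j => ⟨fun h => ?_, fun h => ?_⟩ <;> by_contra! hlt
  · exact h.not_gt (lt_of_index_lt_of_interlaced hShR hThR (fun k => (hSh k).1.2) hlt)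
  · exact h.not_gt (lt_of_index_lt_of_interlaced hThR hShR (fun k => (hTh k).1.2) hlt)
end

section
/- Let m ≥ 1 be an integer. For all indices a, b ≥ 0: if the half-open intervals [Ŝ_a, Ŝ_{a+m}) and [T̂_b, T̂_{b+m}) have nonempty intersection, then |a − b| ≤ m; conversely, if |a − b| ≤ m − 1, then [Ŝ_a, Ŝ_{a+m}) ∩ [T̂_b, T̂_{b+m}) ≠ ∅. -/
open Filter Set

/-- If `X k ≤ R k`, `Y k ≤ R k` and `R k < Y (k + 1)` for all `k`, then every term of `X`
precedes all terms of `Y` of larger index. -/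
theorem lt_of_interlaced {α : Type*} [Preorder α] {X Y R : ℕ → α} (hX : ∀ k, X k ≤ R k)
    (hY : ∀ k, Y k ≤ R k) (hRY : ∀ k, R k < Y (k + 1)) {i j : ℕ} (hij : i < j) :
    X i < Y j := by
  have hR : Monotone R := monotone_nat_of_le_succ fun k => (hRY k).le.trans (hY (k + 1))
  obtain ⟨k, rfl⟩ := Nat.exists_eq_add_of_lt hij
  exact (hX i).trans_lt ((hR (Nat.le_add_right i k)).trans_lt (hRY (i + k)))

/-- For an integer `m ≥ 1` and indices `a, b ≥ 0`: if the half-open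
intervals `[Ŝ a, Ŝ (a+m))` and `[T̂ b, T̂ (b+m))` intersect then `|a − b| ≤ m`;
conversely if `|a − b| ≤ m − 1` then they intersect. -/
theorem stmt2 (S T R Sh Th : ℕ → ℝ)
    (hS : StrictMono S) (hT : StrictMono T)
    (hSnn : ∀ i, 0 ≤ S i) (hTnn : ∀ j, 0 ≤ T j)
    (hSlim : Tendsto S atTop atTop) (hTlim : Tendsto T atTop atTop)
    (hR0 : R 0 = max (S 0) (T 0))
    (hSh0 : Sh 0 = S 0) (hTh0 : Th 0 = T 0)
    (hSh : ∀ k : ℕ, IsLeast {x | (∃ i, x = S i) ∧ R k < x} (Sh (k + 1)))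
    (hTh : ∀ k : ℕ, IsLeast {x | (∃ j, x = T j) ∧ R k < x} (Th (k + 1)))
    (hR : ∀ k : ℕ, R (k + 1) = max (Sh (k + 1)) (Th (k + 1)))
    (m : ℕ) (hm : 1 ≤ m) :
    ∀ a b : ℕ,
      ((Set.Ico (Sh a) (Sh (a + m)) ∩ Set.Ico (Th b) (Th (b + m))).Nonempty →
        |(a : ℤ) - (b : ℤ)| ≤ (m : ℤ)) ∧
      (|(a : ℤ) - (b : ℤ)| ≤ (m : ℤ) - 1 →
        (Set.Ico (Sh a) (Sh (a + m)) ∩ Set.Ico (Th b) (Th (b + m))).Nonempty) := by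
  have hShR : ∀ k, Sh k ≤ R k := by
    rintro (_ | k)
    · rw [hSh0, hR0]; exact le_max_left _ _
    · rw [hR]; exact le_max_left _ _
  have hThR : ∀ k, Th k ≤ R k := by
    rintro (_ | k)
    · rw [hTh0, hR0]; exact le_max_right _ _
    · rw [hR]; exact le_max_right _ _
  have hRSh : ∀ k, R k < Sh (k + 1) := fun k => (hSh k).1.2
  have hRTh : ∀ k, R k < Th (k + 1) := fun k => (hTh k).1.2
  intro a b
  rw [Ico_inter_Ico, nonempty_Ico, abs_le, abs_le]
  constructor
  · intro h
    obtain ⟨⟨-, hba⟩, hab, -⟩ : (Sh a < Sh (a + m) ∧ Th b < Sh (a + m)) ∧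
        Sh a < Th (b + m) ∧ Th b < Th (b + m) := by
      simpa only [lt_inf_iff, sup_lt_iff] using h
    constructor
    · by_contra! hlt
      exact hba.not_gt (lt_of_interlaced hShR hThR hRTh (by omega))
    · by_contra! hlt
      exact hab.not_gt (lt_of_interlaced hThR hShR hRSh (by omega))
  · rintro ⟨h₁, h₂⟩
    simp only [lt_inf_iff, sup_lt_iff]
    exact ⟨⟨lt_of_interlaced hShR hShR hRSh (by omega),
      lt_of_interlaced hThR hShR hRSh (by omega)⟩,
      lt_of_interlaced hShR hThR hRTh (by omega),
      lt_of_interlaced hThR hThR hRTh (by omega)⟩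
end

section
/- Let k ≥ 1 be an integer and set K̄^{ij} = 1 if [Ŝ_i, Ŝ_{i+k}) ∩ [T̂_j, T̂_{j+k}) ≠ ∅ and K̄^{ij} = 0 otherwise. Then for every i ≥ 0 one has ∑_{j≥0} K̄^{ij} ≤ 2k + 1, and for every j ≥ 0 one has ∑_{i≥0} K̄^{ij} ≤ 2k + 1. -/
open scoped Classical

open Filter Set ENNReal

/-- If `A n ≤ R n < B (n + 1)` and `B` is monotone, an interval `[A i, A (i + k))` can only meet
`[B j, B (j + k))` when `j ≤ i + k`. -/
theorem le_add_of_Ico_inter_Ico_nonempty {A B R : ℕ → ℝ} (hA : ∀ n, A n ≤ R n)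
    (hB : ∀ n, R n < B (n + 1)) (hmono : Monotone B) {i j k : ℕ}
    (h : (Set.Ico (A i) (A (i + k)) ∩ Set.Ico (B j) (B (j + k))).Nonempty) : j ≤ i + k := by
  obtain ⟨x, ⟨-, hxA⟩, hxB, -⟩ := h
  have hlt : B j < B (i + k + 1) := by linarith [hA (i + k), hB (i + k)]
  exact Nat.lt_succ_iff.mp (hmono.reflect_lt hlt)

/-- A sum of zeros and ones supported within distance `k` of `i` is at most `2 * k + 1`. -/
theorem tsum_le_two_mul_add_one {f : ℕ → ℕ} {i k : ℕ} (hf : ∀ j, f j ≤ 1)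
    (hsupp : ∀ j, f j ≠ 0 → j ≤ i + k ∧ i ≤ j + k) :
    ∑' j, (f j : ℝ≥0∞) ≤ 2 * (k : ℝ≥0∞) + 1 := by
  rw [tsum_eq_sum (s := Finset.Icc (i - k) (i + k))]
  · have hcard : ∑ j ∈ Finset.Icc (i - k) (i + k), f j ≤ 2 * k + 1 := by
      refine (Finset.sum_le_card_nsmul _ _ 1 fun j _ => hf j).trans ?_
      rw [Nat.card_Icc, smul_eq_mul]
      omega
    exact_mod_cast hcard
  · intro j hj
    by_contra hne
    have := hsupp j (by exact_mod_cast hne)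
    rw [Finset.mem_Icc] at hj
    omega

/-- For an integer `k ≥ 1`, with `K̄ i j` the indicator of
`[Ŝ i, Ŝ (i+k)) ∩ [T̂ j, T̂ (j+k)) ≠ ∅`, one has `∑_{j} K̄ i j ≤ 2k + 1` for every `i`
and `∑_{i} K̄ i j ≤ 2k + 1` for every `j`. -/
theorem stmt3 (S T R Sh Th : ℕ → ℝ)
    (hS : StrictMono S) (hT : StrictMono T)
    (hSnn : ∀ i, 0 ≤ S i) (hTnn : ∀ j, 0 ≤ T j)
    (hSlim : Tendsto S atTop atTop) (hTlim : Tendsto T atTop atTop)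
    (hR0 : R 0 = max (S 0) (T 0))
    (hSh0 : Sh 0 = S 0) (hTh0 : Th 0 = T 0)
    (hSh : ∀ k : ℕ, IsLeast {x | (∃ i, x = S i) ∧ R k < x} (Sh (k + 1)))
    (hTh : ∀ k : ℕ, IsLeast {x | (∃ j, x = T j) ∧ R k < x} (Th (k + 1)))
    (hR : ∀ k : ℕ, R (k + 1) = max (Sh (k + 1)) (Th (k + 1)))
    (k : ℕ) (hk : 1 ≤ k) (K : ℕ → ℕ → ℕ)
    (hK : ∀ i j, K i j =
      if (Set.Ico (Sh i) (Sh (i + k)) ∩ Set.Ico (Th j) (Th (j + k))).Nonempty then 1 else 0) :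
    (∀ i : ℕ, ∑' j : ℕ, (K i j : ℝ≥0∞) ≤ 2 * (k : ℝ≥0∞) + 1) ∧
    (∀ j : ℕ, ∑' i : ℕ, (K i j : ℝ≥0∞) ≤ 2 * (k : ℝ≥0∞) + 1) := by
  have hSR : ∀ n, Sh n ≤ R n := by
    rintro (_ | n)
    · rw [hSh0, hR0]; exact le_max_left _ _
    · rw [hR]; exact le_max_left _ _
  have hTR : ∀ n, Th n ≤ R n := by
    rintro (_ | n)
    · rw [hTh0, hR0]; exact le_max_right _ _
    · rw [hR]; exact le_max_right _ _
  have hRS : ∀ n, R n < Sh (n + 1) := fun n => (hSh n).1.2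
  have hRT : ∀ n, R n < Th (n + 1) := fun n => (hTh n).1.2
  have hSmono : Monotone Sh := monotone_nat_of_le_succ fun n => (hSR n).trans (hRS n).le
  have hTmono : Monotone Th := monotone_nat_of_le_succ fun n => (hTR n).trans (hRT n).le
  have hK1 : ∀ i j, K i j ≤ 1 := by
    intro i j
    rw [hK]
    split_ifs <;> simp
  have hsupp : ∀ i j, K i j ≠ 0 → j ≤ i + k ∧ i ≤ j + k := by
    intro i j hne
    rw [hK] at hne
    have h := (ite_ne_right_iff.mp hne).1
    exact ⟨le_add_of_Ico_inter_Ico_nonempty hSR hRT hTmono h,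
      le_add_of_Ico_inter_Ico_nonempty hTR hRS hSmono (Set.inter_comm _ _ ▸ h)⟩
  exact ⟨fun i => tsum_le_two_mul_add_one (hK1 i) (hsupp i),
    fun j => tsum_le_two_mul_add_one (fun i => hK1 i j) fun i hne => (hsupp i j hne).symm⟩
end

section
/- Set Î_p = [Ŝ_{p−1}, Ŝ_p) and Ĵ_q = [T̂_{q−1}, T̂_q) for p, q ≥ 1. If Î_p ∩ Ĵ_q ≠ ∅ then |p − q| ≤ 1; consequently, for every p ≥ 1 at most three indices q satisfy Î_p ∩ Ĵ_q ≠ ∅, and for every q ≥ 1 at most three indices p satisfy Î_p ∩ Ĵ_q ≠ ∅. -/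
open Filter Set

/-- If `A k ≤ R k < B (k + 1)` for a monotone `R`, then `[A (p-1), A p)` can meet
`[B (q-1), B q)` only when `q ≤ p + 1`. -/
lemma le_add_one_of_Ico_inter_Ico_nonempty {A B R : ℕ → ℝ} (hmono : Monotone R)
    (hA : ∀ k, A k ≤ R k) (hB : ∀ k, R k < B (k + 1)) {p q : ℕ}
    (h : (Set.Ico (A (p - 1)) (A p) ∩ Set.Ico (B (q - 1)) (B q)).Nonempty) :
    q ≤ p + 1 := by
  obtain ⟨x, ⟨-, hxA⟩, hxB, -⟩ := h
  by_contra! hpq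
  obtain ⟨m, rfl⟩ : ∃ m, q = m + 2 := ⟨q - 2, by omega⟩
  have hRm : R p ≤ R m := hmono (by omega)
  have hBm : R m < B (m + 1) := hB m
  rw [show m + 2 - 1 = m + 1 by omega] at hxB
  linarith [hA p]

/-- A set of naturals within distance one of `n` has at most three elements. -/
lemma encard_le_three_of_abs_sub_le_one {s : Set ℕ} (n : ℕ)
    (h : ∀ m ∈ s, |(n : ℤ) - (m : ℤ)| ≤ 1) : s.encard ≤ 3 := by
  have hsub : s ⊆ (Finset.Icc (n - 1) (n + 1) : Finset ℕ) := by
    intro m hm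
    have := abs_le.mp (h m hm)
    simp only [Finset.coe_Icc, Set.mem_Icc]
    omega
  refine (Set.encard_le_encard hsub).trans ?_
  rw [Set.encard_coe_eq_coe_finsetCard, Nat.card_Icc]
  exact_mod_cast (show n + 1 + 1 - (n - 1) ≤ 3 by omega)

/-- With `Î p = [Ŝ (p−1), Ŝ p)` and `Ĵ q = [T̂ (q−1), T̂ q)` for `p, q ≥ 1`:
if `Î p ∩ Ĵ q ≠ ∅` then `|p − q| ≤ 1`; consequently for every `p ≥ 1` at most three
indices `q` satisfy `Î p ∩ Ĵ q ≠ ∅`, and symmetrically. -/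
theorem stmt4 (S T R Sh Th : ℕ → ℝ)
    (hS : StrictMono S) (hT : StrictMono T)
    (hSnn : ∀ i, 0 ≤ S i) (hTnn : ∀ j, 0 ≤ T j)
    (hSlim : Tendsto S atTop atTop) (hTlim : Tendsto T atTop atTop)
    (hR0 : R 0 = max (S 0) (T 0))
    (hSh0 : Sh 0 = S 0) (hTh0 : Th 0 = T 0)
    (hSh : ∀ k : ℕ, IsLeast {x | (∃ i, x = S i) ∧ R k < x} (Sh (k + 1)))
    (hTh : ∀ k : ℕ, IsLeast {x | (∃ j, x = T j) ∧ R k < x} (Th (k + 1)))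
    (hR : ∀ k : ℕ, R (k + 1) = max (Sh (k + 1)) (Th (k + 1))) :
    (∀ p q : ℕ, 1 ≤ p → 1 ≤ q →
      (Set.Ico (Sh (p - 1)) (Sh p) ∩ Set.Ico (Th (q - 1)) (Th q)).Nonempty →
        |(p : ℤ) - (q : ℤ)| ≤ 1) ∧
    (∀ p : ℕ, 1 ≤ p →
      Set.encard {q : ℕ | 1 ≤ q ∧
        (Set.Ico (Sh (p - 1)) (Sh p) ∩ Set.Ico (Th (q - 1)) (Th q)).Nonempty} ≤ 3) ∧
    (∀ q : ℕ, 1 ≤ q →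
      Set.encard {p : ℕ | 1 ≤ p ∧
        (Set.Ico (Sh (p - 1)) (Sh p) ∩ Set.Ico (Th (q - 1)) (Th q)).Nonempty} ≤ 3) := by
  have hSR : ∀ k, Sh k ≤ R k
    | 0 => by rw [hSh0, hR0]; exact le_max_left _ _
    | k + 1 => by rw [hR]; exact le_max_left _ _
  have hTR : ∀ k, Th k ≤ R k
    | 0 => by rw [hTh0, hR0]; exact le_max_right _ _
    | k + 1 => by rw [hR]; exact le_max_right _ _
  have hRS : ∀ k, R k < Sh (k + 1) := fun k => (hSh k).1.2
  have hRT : ∀ k, R k < Th (k + 1) := fun k => (hTh k).1.2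
  have hmono : Monotone R :=
    monotone_nat_of_le_succ fun k => (hRS k).le.trans (hSR (k + 1))
  have key : ∀ p q : ℕ,
      (Set.Ico (Sh (p - 1)) (Sh p) ∩ Set.Ico (Th (q - 1)) (Th q)).Nonempty →
        |(p : ℤ) - (q : ℤ)| ≤ 1 := by
    intro p q h
    have hq := le_add_one_of_Ico_inter_Ico_nonempty hmono hSR hRT h
    rw [Set.inter_comm] at h
    have hp := le_add_one_of_Ico_inter_Ico_nonempty hmono hTR hRS h
    rw [abs_le]
    omega
  refine ⟨fun p q _ _ => key p q, fun p _ => ?_, fun q _ => ?_⟩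
  · exact encard_le_three_of_abs_sub_le_one p fun q hq => key p q hq.2
  · refine encard_le_three_of_abs_sub_le_one q fun p hp => ?_
    rw [abs_sub_comm]
    exact key p q hp.2
end

section
/- Let α, β : ℝ → ℝ be piecewise Lipschitz with support in [0,1]. For an integer k ≥ 1 set K̄^{ij} = 1 if [Ŝ_i, Ŝ_{i+k}) ∩ [T̂_j, T̂_{j+k}) ≠ ∅ and K̄^{ij} = 0 otherwise, and for integers p, q ≥ 1 define c_{α,β}(p,q) = k^{−2} ∑_{i=max(p−k+1,1)}^{p} ∑_{j=max(q−k+1,1)}^{q} α((p−i)/k) β((q−j)/k) K̄^{ij}. Then there exists a constant C, depending only on α and β (in particular not on k and not on the sequences (S_i), (T_j)), such that for every k ≥ 1, sup over all p, q ≥ k of |c_{α,β}(p,q) − ψ_{α,β}((q−p)/k)| is at most C/k. -/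
open scoped Classical

open Filter Set MeasureTheory

/-- `ψ_{α,β}(x) = ∫_0^1 ∫_{x+u−1}^{x+u+1} α(u) β(v) dv du`. -/
noncomputable def psi (α β : ℝ → ℝ) (x : ℝ) : ℝ :=
  ∫ u in (0:ℝ)..1, α u * ∫ v in (x + u - 1)..(x + u + 1), β v

/-- `α : ℝ → ℝ` is piecewise Lipschitz with support in `[0,1]`: it vanishes outside
`[0,1]` and there are points `0 = t 0 < ⋯ < t r = 1` and `L ≥ 0` such that `α` is
`L`-Lipschitz on each `[t l, t (l+1))`. -/
def PiecewiseLipschitzOn01 (α : ℝ → ℝ) : Prop :=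
  (∀ x, x ∉ Set.Icc (0:ℝ) 1 → α x = 0) ∧
  ∃ (r : ℕ) (t : ℕ → ℝ) (L : ℝ), 0 ≤ L ∧ 1 ≤ r ∧ t 0 = 0 ∧ t r = 1 ∧
    (∀ l, l < r → t l < t (l + 1)) ∧
    (∀ l, l < r → ∀ x ∈ Set.Ico (t l) (t (l + 1)), ∀ y ∈ Set.Ico (t l) (t (l + 1)),
      |α x - α y| ≤ L * |x - y|)

lemma PiecewiseLipschitzOn01.integrable_bound_oscillation {α : ℝ → ℝ}
    (hα : PiecewiseLipschitzOn01 α) :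
    Integrable α ∧ ∃ M C : ℝ, 0 ≤ M ∧ (∀ x, |α x| ≤ M) ∧
      ∀ k : ℕ, 1 ≤ k → ∃ e : ℕ → ℝ, (∀ a, 0 ≤ e a) ∧ ∑ a ∈ Finset.range k, e a ≤ C ∧
        ∀ a < k, ∀ u ∈ Ico ((a : ℝ) / k) ((a + 1 : ℝ) / k), |α (a / k) - α u| ≤ e a := by
  obtain ⟨h0, r, t, L, hL, hr, ht0, htr, hlt, hlip⟩ := hα
  have hfind : ∀ x : ℝ, 0 ≤ x → x < 1 → ∃ l < r, x ∈ Ico (t l) (t (l + 1)) := by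
    intro x hx0 hx1
    have hex : ∃ n, x < t n := ⟨r, htr ▸ hx1⟩
    have hs := Nat.find_spec hex
    have hle : Nat.find hex ≤ r := Nat.find_min' hex (htr ▸ hx1)
    have hne : Nat.find hex ≠ 0 := by
      intro h
      rw [h, ht0] at hs
      linarith
    obtain ⟨l, hl⟩ := Nat.exists_eq_succ_of_ne_zero hne
    have hmin := Nat.find_min hex (m := l) (by omega)
    rw [hl] at hs hle
    exact ⟨l, by omega, not_lt.mp hmin, hs⟩
  set M : ℝ := ∑ l ∈ Finset.range r, (|α (t l)| + L * (t (l + 1) - t l)) + |α 1| with hM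
  have hterm : ∀ l ∈ Finset.range r, 0 ≤ |α (t l)| + L * (t (l + 1) - t l) := by
    intro l hl
    have := hlt l (Finset.mem_range.mp hl)
    have : 0 ≤ L * (t (l + 1) - t l) := mul_nonneg hL (by linarith)
    positivity
  have hM0 : 0 ≤ M := add_nonneg (Finset.sum_nonneg hterm) (abs_nonneg _)
  have hbound : ∀ x, |α x| ≤ M := by
    intro x
    by_cases hx : x ∈ Icc (0 : ℝ) 1
    · rcases hx.2.lt_or_eq with hx1 | rfl
      · obtain ⟨l, hl, hxl⟩ := hfind x hx.1 hx1
        have h1 := hlip l hl x hxl (t l) ⟨le_rfl, hlt l hl⟩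
        have h2 : L * |x - t l| ≤ L * (t (l + 1) - t l) := by
          rw [abs_of_nonneg (by linarith [hxl.1])]
          exact mul_le_mul_of_nonneg_left (by linarith [hxl.2]) hL
        have h3 := Finset.single_le_sum hterm (Finset.mem_range.mpr hl)
        have h4 := abs_sub_abs_le_abs_sub (α x) (α (t l))
        linarith [abs_nonneg (α 1)]
      · linarith [Finset.sum_nonneg hterm]
    · rw [h0 x hx, abs_zero]
      exact hM0
  refine ⟨?_, M, L + 2 * M * r, hM0, hbound, ?_⟩
  · have hpiece : ∀ l < r, IntervalIntegrable α volume (t l) (t (l + 1)) := by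
      intro l hl
      rw [intervalIntegrable_iff_integrableOn_Ico_of_le (hlt l hl).le]
      have hcont : ContinuousOn α (Ico (t l) (t (l + 1))) := by
        have : LipschitzOnWith L.toNNReal α (Ico (t l) (t (l + 1))) := by
          refine LipschitzOnWith.of_dist_le_mul fun x hx y hy ↦ ?_
          rw [Real.dist_eq, Real.dist_eq, Real.coe_toNNReal L hL]
          exact hlip l hl x hx y hy
        exact this.continuousOn
      exact IntegrableOn.of_bound measure_Ico_lt_top
        (hcont.aestronglyMeasurable measurableSet_Ico) M (ae_of_all _ hbound)
    have hint := IntervalIntegrable.trans_iterate hpiece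
    rw [ht0, htr, intervalIntegrable_iff_integrableOn_Icc_of_le zero_le_one] at hint
    refine (integrableOn_iff_integrable_of_support_subset ?_).mp hint
    intro x hx
    by_contra h
    exact hx (h0 x h)
  · intro k hk
    have hk0 : (0 : ℝ) < k := by exact_mod_cast hk
    let I : ℕ → ℕ → ℝ := fun a l ↦ if (a : ℝ) / k < t (l + 1) ∧ t (l + 1) < (a + 1) / k then 1 else 0
    have hI : ∀ a l, 0 ≤ I a l := by
      intro a l
      dsimp only [I]
      split_ifs <;> norm_num
    refine ⟨fun a ↦ L / k + 2 * M * ∑ l ∈ Finset.range r, I a l, ?_, ?_, ?_⟩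
    · intro a
      have := Finset.sum_nonneg (fun l (_ : l ∈ Finset.range r) ↦ hI a l)
      positivity
    · rw [Finset.sum_add_distrib, ← Finset.mul_sum, Finset.sum_comm]
      have h1 : ∑ l ∈ Finset.range r, ∑ a ∈ Finset.range k, I a l ≤ r := by
        have : ∀ l ∈ Finset.range r, ∑ a ∈ Finset.range k, I a l ≤ 1 := by
          intro l _
          dsimp only [I]
          rw [Finset.sum_boole]
          norm_cast
          refine Finset.card_le_one.mpr fun a ha b hb ↦ ?_
          simp only [Finset.mem_filter, div_lt_iff₀ hk0, lt_div_iff₀ hk0] at ha hb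
          push_cast at ha hb
          have e1 : (a : ℝ) < b + 1 := by linarith [ha.2.1, hb.2.2]
          have e2 : (b : ℝ) < a + 1 := by linarith [hb.2.1, ha.2.2]
          norm_cast at e1 e2
          omega
        simpa using Finset.sum_le_card_nsmul _ _ _ this
      have h2 : ∑ a ∈ Finset.range k, L / (k : ℝ) = L := by
        rw [Finset.sum_const, Finset.card_range, nsmul_eq_mul]
        field_simp
      rw [h2]
      have := mul_le_mul_of_nonneg_left h1 (by positivity : 0 ≤ 2 * M)
      linarith
    · intro a ha u hu
      have ha1 : (a : ℝ) / k < 1 := by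
        rw [div_lt_one hk0]
        exact_mod_cast ha
      obtain ⟨l, hl, hal⟩ := hfind (a / k) (by positivity) ha1
      have hsum := Finset.single_le_sum (fun l (_ : l ∈ Finset.range r) ↦ hI a l)
        (Finset.mem_range.mpr hl)
      by_cases hul : u < t (l + 1)
      · have h1 := hlip l hl _ hal u ⟨hal.1.trans hu.1, hul⟩
        have h2 : |(a : ℝ) / k - u| ≤ 1 / k := by
          rw [abs_sub_comm, abs_of_nonneg (by linarith [hu.1])]
          have := hu.2
          rw [add_div] at this
          linarith
        have h3 := mul_le_mul_of_nonneg_left h2 hL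
        have h4 : 0 ≤ 2 * M * ∑ l ∈ Finset.range r, I a l :=
          mul_nonneg (by positivity) ((hI a l).trans hsum)
        rw [mul_one_div] at h3
        linarith
      · have hone : I a l = 1 := if_pos ⟨hal.2, (not_lt.mp hul).trans_lt hu.2⟩
        rw [hone] at hsum
        have h1 := abs_sub (α (a / k)) (α u)
        have h2 := hbound (a / k)
        have h3 := hbound u
        have h4 := mul_le_mul_of_nonneg_left hsum (by positivity : 0 ≤ 2 * M)
        have h5 : 0 ≤ L / k := by positivity
        linarith

lemma abs_riemann_sum_sub_integral_le {f : ℝ → ℝ} (hf : IntervalIntegrable f volume 0 1)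
    {k : ℕ} (hk : 1 ≤ k) (c e : ℕ → ℝ)
    (h : ∀ a < k, ∀ u ∈ Ico ((a : ℝ) / k) ((a + 1 : ℝ) / k), |c a - f u| ≤ e a) :
    |1 / (k : ℝ) * ∑ a ∈ Finset.range k, c a - ∫ u in (0 : ℝ)..1, f u| ≤
      1 / (k : ℝ) * ∑ a ∈ Finset.range k, e a := by
  have hk0 : (0 : ℝ) < k := by exact_mod_cast hk
  have hle : ∀ a : ℕ, (a : ℝ) / k ≤ ((a + 1 : ℕ) : ℝ) / k := fun a ↦ by
    gcongr
    exact_mod_cast Nat.le_succ a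
  have hint : ∀ a < k, IntervalIntegrable f volume ((a : ℝ) / k) (((a + 1 : ℕ) : ℝ) / k) := by
    intro a ha
    refine hf.mono_set ?_
    rw [uIcc_of_le (hle a), uIcc_of_le zero_le_one]
    refine Icc_subset_Icc (by positivity) ?_
    rw [div_le_one hk0]
    exact_mod_cast ha
  have hsum := intervalIntegral.sum_integral_adjacent_intervals
    (a := fun a : ℕ ↦ (a : ℝ) / k) hint
  simp only [Nat.cast_zero, zero_div, div_self hk0.ne'] at hsum
  rw [← hsum, Finset.mul_sum, Finset.mul_sum, ← Finset.sum_sub_distrib]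
  refine (Finset.abs_sum_le_sum_abs _ _).trans (Finset.sum_le_sum fun a ha ↦ ?_)
  have ha' := Finset.mem_range.mp ha
  have hlen : ((a + 1 : ℕ) : ℝ) / k - (a : ℝ) / k = 1 / k := by
    push_cast
    ring
  have hconst : 1 / (k : ℝ) * c a = ∫ _ in ((a : ℝ) / k)..(((a + 1 : ℕ) : ℝ) / k), c a := by
    rw [intervalIntegral.integral_const, hlen, smul_eq_mul]
  rw [hconst, ← intervalIntegral.integral_sub intervalIntegrable_const (hint a ha'),
    ← Real.norm_eq_abs]
  have hae : ∀ᵐ u : ℝ, u ∈ uIoc ((a : ℝ) / k) (((a + 1 : ℕ) : ℝ) / k) → ‖c a - f u‖ ≤ e a := by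
    filter_upwards [Measure.ae_ne volume (((a + 1 : ℕ) : ℝ) / k)] with u hne hu
    rw [uIoc_of_le (hle a)] at hu
    refine h a ha' u ⟨hu.1.le, ?_⟩
    have := lt_of_le_of_ne hu.2 hne
    push_cast at this
    exact this
  have := intervalIntegral.norm_integral_le_of_norm_le_const_ae hae
  rw [hlen, abs_of_nonneg (by positivity)] at this
  linarith

lemma abs_double_sum_sub_psi_le {α β : ℝ → ℝ}
    (hα : PiecewiseLipschitzOn01 α) (hβ : PiecewiseLipschitzOn01 β) :
    ∃ C : ℝ, ∀ k : ℕ, 1 ≤ k → ∀ (d : ℤ) (K : ℕ → ℕ → ℝ),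
      (∀ a b, K a b = 0 ∨ K a b = 1) →
      (∀ a < k, ∀ b < k, |(b : ℤ) - a - d| < k → K a b = 1) →
      (∀ a < k, ∀ b < k, (k : ℤ) < |(b : ℤ) - a - d| → K a b = 0) →
      |1 / (k : ℝ) ^ 2 * (∑ a ∈ Finset.range k, ∑ b ∈ Finset.range k,
        α (a / k) * β (b / k) * K a b) - psi α β (d / k)| ≤ C / k := by
  obtain ⟨hαi, Mα, Cα, hMα, hαb, hαe⟩ := hα.integrable_bound_oscillation
  obtain ⟨hβi, Mβ, Cβ, hMβ, hβb, hβe⟩ := hβ.integrable_bound_oscillation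
  refine ⟨Cα * Mβ + Mα * (Cβ + 2 * Mβ), fun k hk d K hK hK1 hK0 ↦ ?_⟩
  have hk0 : (0 : ℝ) < k := by exact_mod_cast hk
  obtain ⟨eα, heα0, heαs, heα⟩ := hαe k hk
  obtain ⟨eβ, heβ0, heβs, heβ⟩ := hβe k hk
  set x : ℝ := d / k
  let G : ℝ → ℝ := fun u ↦ ∫ v in (x + u - 1)..(x + u + 1), β v
  let g : ℕ → ℝ := fun a ↦ 1 / (k : ℝ) * ∑ b ∈ Finset.range k, β (b / k) * K a b
  have hG : Continuous G := by
    have hp := intervalIntegral.continuous_primitive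
      (fun a b ↦ hβi.intervalIntegrable (a := a) (b := b)) 0
    have : G = fun u ↦ (∫ v in (0 : ℝ)..(x + u + 1), β v) - ∫ v in (0 : ℝ)..(x + u - 1), β v := by
      funext u
      exact (intervalIntegral.integral_interval_sub_left
        hβi.intervalIntegrable hβi.intervalIntegrable).symm
    rw [this]
    exact (hp.comp (by fun_prop : Continuous fun u : ℝ ↦ x + u + 1)).sub
      (hp.comp (by fun_prop : Continuous fun u : ℝ ↦ x + u - 1))
  have hg : ∀ a, |g a| ≤ Mβ := by
    intro a
    have h1 : |∑ b ∈ Finset.range k, β (b / k) * K a b| ≤ k * Mβ := by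
      refine (Finset.abs_sum_le_sum_abs _ _).trans ?_
      have : ∀ b ∈ Finset.range k, |β (b / k) * K a b| ≤ Mβ := by
        intro b _
        rcases hK a b with h | h <;> simp [h, hMβ, hβb]
      simpa using Finset.sum_le_card_nsmul _ _ _ this
    dsimp only [g]
    rw [abs_mul, abs_of_pos (by positivity)]
    rw [one_div, inv_mul_le_iff₀ hk0]
    exact h1
  have hgG : ∀ a < k, ∀ u ∈ Ico ((a : ℝ) / k) ((a + 1 : ℝ) / k),
      |g a - G u| ≤ (Cβ + 2 * Mβ) / k := by
    intro a ha u hu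
    have hGind : G u = ∫ v in (0 : ℝ)..1, (Ioc (x + u - 1) (x + u + 1)).indicator β v := by
      dsimp only [G]
      rw [intervalIntegral.integral_of_le (by linarith), ← integral_indicator measurableSet_Ioc,
        intervalIntegral.integral_of_le zero_le_one, ← integral_Icc_eq_integral_Ioc]
      refine (setIntegral_eq_integral_of_forall_compl_eq_zero fun v hv ↦ ?_).symm
      simp [indicator, hβ.1 v hv]
    let J : ℕ → ℝ := fun b ↦ if |(b : ℤ) - a - d| = k then 1 else 0
    have hcell : ∀ b < k, ∀ v ∈ Ico ((b : ℝ) / k) ((b + 1 : ℝ) / k),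
        |β (b / k) * K a b - (Ioc (x + u - 1) (x + u + 1)).indicator β v| ≤
          eβ b + Mβ * J b := by
      intro b hb v hv
      have hosc := heβ b hb v hv
      have hu' : (a : ℝ) ≤ u * k ∧ u * k < a + 1 :=
        ⟨(div_le_iff₀ hk0).mp hu.1, (lt_div_iff₀ hk0).mp hu.2⟩
      have hv' : (b : ℝ) ≤ v * k ∧ v * k < b + 1 :=
        ⟨(div_le_iff₀ hk0).mp hv.1, (lt_div_iff₀ hk0).mp hv.2⟩
      have hxk : x * k = d := div_mul_cancel₀ _ hk0.ne'
      rcases lt_trichotomy |(b : ℤ) - a - d| (k : ℤ) with h | h | h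
      · have hmem : v ∈ Ioc (x + u - 1) (x + u + 1) := by
          rw [abs_lt] at h
          have e1 : (-(k : ℝ)) + 1 ≤ b - a - d := by exact_mod_cast h.1
          have e2 : (b : ℝ) - a - d + 1 ≤ k := by exact_mod_cast h.2
          constructor
          · refine lt_of_mul_lt_mul_right ?_ hk0.le
            linarith
          · refine le_of_mul_le_mul_right ?_ hk0
            linarith
        rw [hK1 a ha b hb h, indicator_of_mem hmem]
        simp only [J, if_neg h.ne]
        simpa using hosc
      · simp only [J, if_pos h]
        have h1 := hβb (b / k)
        have h2 := hβb v
        have h3 := heβ0 b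
        rcases hK a b with h4 | h4 <;> by_cases hmem : v ∈ Ioc (x + u - 1) (x + u + 1) <;>
          simp only [h4, indicator, hmem, if_true, if_false, mul_one, mul_zero, sub_zero,
            zero_sub, abs_neg, abs_zero] <;> linarith
      · have hmem : v ∉ Ioc (x + u - 1) (x + u + 1) := by
          rintro ⟨m1, m2⟩
          have m1' := mul_lt_mul_of_pos_right m1 hk0
          have m2' := mul_le_mul_of_nonneg_right m2 hk0.le
          rcases lt_abs.mp h with h | h
          · have e1 : (k : ℝ) + 1 ≤ b - a - d := by exact_mod_cast h
            linarith
          · have e1 : (k : ℝ) + 1 ≤ -(b - a - d) := by exact_mod_cast h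
            linarith
        rw [hK0 a ha b hb h, indicator_of_notMem hmem]
        simp only [J, if_neg h.ne']
        simpa using heβ0 b
    have hJ : ∑ b ∈ Finset.range k, J b ≤ 2 := by
      dsimp only [J]
      rw [Finset.sum_boole]
      have hsub : (Finset.range k).filter (fun b : ℕ ↦ |(b : ℤ) - a - d| = k) ⊆
          {((a : ℤ) + d + k).toNat, ((a : ℤ) + d - k).toNat} := by
        intro b hb
        have h := (Finset.mem_filter.mp hb).2
        simp only [Finset.mem_insert, Finset.mem_singleton]
        rcases abs_choice ((b : ℤ) - a - d) with h' | h' <;> omega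
      exact_mod_cast (Finset.card_le_card hsub).trans Finset.card_le_two
    have hri := abs_riemann_sum_sub_integral_le
      ((hβi.indicator measurableSet_Ioc).intervalIntegrable) hk _ _ hcell
    rw [← hGind] at hri
    refine hri.trans ?_
    rw [one_div, inv_mul_eq_div, Finset.sum_add_distrib, ← Finset.mul_sum]
    have := mul_le_mul_of_nonneg_left hJ hMβ
    refine div_le_div_of_nonneg_right ?_ hk0.le
    linarith
  have hcell : ∀ a < k, ∀ u ∈ Ico ((a : ℝ) / k) ((a + 1 : ℝ) / k),
      |α (a / k) * g a - α u * G u| ≤ eα a * Mβ + Mα * ((Cβ + 2 * Mβ) / k) := by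
    intro a ha u hu
    have h1 : α (a / k) * g a - α u * G u =
        (α (a / k) - α u) * g a + α u * (g a - G u) := by ring
    rw [h1]
    refine (abs_add_le _ _).trans ?_
    rw [abs_mul _ (g a), abs_mul _ (g a - G u)]
    exact add_le_add
      (mul_le_mul (heα a ha u hu) (hg a) (abs_nonneg _) (heα0 a))
      (mul_le_mul (hαb u) (hgG a ha u hu) (abs_nonneg _) hMα)
  have hri := abs_riemann_sum_sub_integral_le
    ((hαi.intervalIntegrable (a := 0) (b := 1)).mul_continuousOn hG.continuousOn) hk _ _ hcell
  have hlhs : 1 / (k : ℝ) ^ 2 * (∑ a ∈ Finset.range k, ∑ b ∈ Finset.range k,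
      α (a / k) * β (b / k) * K a b) = 1 / (k : ℝ) * ∑ a ∈ Finset.range k, α (a / k) * g a := by
    dsimp only [g]
    simp only [Finset.mul_sum]
    refine Finset.sum_congr rfl fun a _ ↦ Finset.sum_congr rfl fun b _ ↦ ?_
    field_simp
  rw [hlhs]
  refine hri.trans ?_
  rw [one_div, inv_mul_eq_div, Finset.sum_add_distrib, ← Finset.sum_mul, Finset.sum_const,
    Finset.card_range, nsmul_eq_mul]
  have h1 : (k : ℝ) * (Mα * ((Cβ + 2 * Mβ) / k)) = Mα * (Cβ + 2 * Mβ) := by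
    field_simp
  rw [h1]
  gcongr

lemma lt_of_interlaced_s5 {A B R : ℕ → ℝ} (hA : ∀ n, A n ≤ R n) (hR : Monotone R)
    (hB : ∀ n, R n < B (n + 1)) {m n : ℕ} (h : m < n) : A m < B n := by
  obtain ⟨l, rfl⟩ := Nat.exists_eq_succ_of_ne_zero (Nat.ne_zero_of_lt h)
  exact ((hA m).trans (hR (Nat.lt_succ_iff.mp h))).trans_lt (hB l)

lemma sum_Icc_eq_sum_range_sub {p k : ℕ} (h : k ≤ p) (f : ℕ → ℝ) :
    ∑ i ∈ Finset.Icc (max (p + 1 - k) 1) p, f i = ∑ a ∈ Finset.range k, f (p - a) := by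
  refine Finset.sum_nbij' (fun i ↦ p - i) (fun a ↦ p - a) ?_ ?_ ?_ ?_ ?_
  · intro i hi
    simp only [Finset.mem_Icc, Finset.mem_range] at *
    omega
  · intro i hi
    simp only [Finset.mem_Icc, Finset.mem_range] at *
    omega
  · intro i hi
    simp only [Finset.mem_Icc] at *
    omega
  · intro i hi
    simp only [Finset.mem_range] at *
    omega
  · intro i hi
    simp only [Finset.mem_Icc] at hi
    congr 1
    omega

/-- for piecewise Lipschitz `α, β` supported in `[0,1]` there is a constant
`C` (depending only on `α, β`) such that for every refresh-time sampling scheme, every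
`k ≥ 1` and all `p, q ≥ k`, `|c_{α,β}(p,q) − ψ_{α,β}((q−p)/k)| ≤ C / k`. -/
theorem stmt5 (α β : ℝ → ℝ)
    (hα : PiecewiseLipschitzOn01 α) (hβ : PiecewiseLipschitzOn01 β) :
    ∃ C : ℝ, ∀ S T R Sh Th : ℕ → ℝ,
      StrictMono S → StrictMono T → (∀ i, 0 ≤ S i) → (∀ j, 0 ≤ T j) →
      Tendsto S atTop atTop → Tendsto T atTop atTop →
      R 0 = max (S 0) (T 0) → Sh 0 = S 0 → Th 0 = T 0 →
      (∀ k : ℕ, IsLeast {x | (∃ i, x = S i) ∧ R k < x} (Sh (k + 1))) →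
      (∀ k : ℕ, IsLeast {x | (∃ j, x = T j) ∧ R k < x} (Th (k + 1))) →
      (∀ k : ℕ, R (k + 1) = max (Sh (k + 1)) (Th (k + 1))) →
      ∀ k : ℕ, 1 ≤ k → ∀ p q : ℕ, k ≤ p → k ≤ q →
        |(1 / (k : ℝ) ^ 2) *
            (∑ i ∈ Finset.Icc (max (p + 1 - k) 1) p, ∑ j ∈ Finset.Icc (max (q + 1 - k) 1) q,
              α (((p : ℝ) - (i : ℝ)) / k) * β (((q : ℝ) - (j : ℝ)) / k) *
                (if (Set.Ico (Sh i) (Sh (i + k)) ∩ Set.Ico (Th j) (Th (j + k))).Nonempty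
                  then (1 : ℝ) else 0)) -
          psi α β (((q : ℝ) - (p : ℝ)) / k)| ≤ C / k := by
  obtain ⟨C, hC⟩ := abs_double_sum_sub_psi_le hα hβ
  refine ⟨C, fun S T R Sh Th _ _ _ _ _ _ hR0 hS0 hT0 hS hT hR k hk p q hp hq ↦ ?_⟩
  have hSR : ∀ n, Sh n ≤ R n := by
    rintro (_ | n)
    · rw [hS0, hR0]
      exact le_max_left _ _
    · rw [hR]
      exact le_max_left _ _
  have hTR : ∀ n, Th n ≤ R n := by
    rintro (_ | n)
    · rw [hT0, hR0]
      exact le_max_right _ _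
    · rw [hR]
      exact le_max_right _ _
  have hRS : ∀ n, R n < Sh (n + 1) := fun n ↦ (hS n).1.2
  have hRT : ∀ n, R n < Th (n + 1) := fun n ↦ (hT n).1.2
  have hRm : Monotone R := monotone_nat_of_le_succ fun n ↦ (hRS n).le.trans (hSR _)
  let K : ℕ → ℕ → ℝ := fun a b ↦
    if (Set.Ico (Sh (p - a)) (Sh (p - a + k)) ∩ Set.Ico (Th (q - b)) (Th (q - b + k))).Nonempty
      then (1 : ℝ) else 0
  have key := hC k hk ((q : ℤ) - p) K ?_ ?_ ?_
  · push_cast at key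
    convert key using 4
    rw [sum_Icc_eq_sum_range_sub hp]
    refine Finset.sum_congr rfl fun a ha ↦ ?_
    rw [sum_Icc_eq_sum_range_sub hq]
    refine Finset.sum_congr rfl fun b hb ↦ ?_
    have ha' : a ≤ p := by have := Finset.mem_range.mp ha; omega
    have hb' : b ≤ q := by have := Finset.mem_range.mp hb; omega
    rw [Nat.cast_sub ha', Nat.cast_sub hb', sub_sub_cancel, sub_sub_cancel]
  · intro a b
    dsimp only [K]
    split_ifs <;> simp
  · intro a ha b hb h
    rw [abs_lt] at h
    refine if_pos ⟨max (Sh (p - a)) (Th (q - b)), ⟨le_max_left _ _, max_lt ?_ ?_⟩,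
      ⟨le_max_right _ _, max_lt ?_ ?_⟩⟩
    · exact lt_of_interlaced_s5 hSR hRm hRS (by omega)
    · exact lt_of_interlaced_s5 hTR hRm hRS (by omega)
    · exact lt_of_interlaced_s5 hSR hRm hRT (by omega)
    · exact lt_of_interlaced_s5 hTR hRm hRT (by omega)
  · intro a ha b hb h
    refine if_neg ?_
    rintro ⟨y, ⟨hy1, hy2⟩, ⟨hy3, hy4⟩⟩
    rcases lt_abs.mp h with h | h
    · have := lt_of_interlaced_s5 hTR hRm hRS (m := q - b + k) (n := p - a) (by omega)
      linarith
    · have := lt_of_interlaced_s5 hSR hRm hRT (m := p - a + k) (n := q - b) (by omega)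
      linarith
end

section
/- Let α, β : ℝ → ℝ be piecewise Lipschitz with support in [0,1]. There exists a constant C, depending only on α and β, such that for every integer k ≥ 1 and every integer m ∈ ℤ, |k^{−2} ∑_{i=0}^{k−1} α(i/k) ∑_{j=m+i−k}^{m+i+k} β(j/k) − ψ_{α,β}(m/k)| ≤ C/k. -/
open Filter Set MeasureTheory

/-- If `t 0 ≤ x < t r`, some step `[t l, t (l + 1))` contains `x`. -/
theorem exists_mem_Ico_step {t : ℕ → ℝ} {x : ℝ} (r : ℕ) (h0 : t 0 ≤ x) (hr : x < t r) :
    ∃ l < r, x ∈ Ico (t l) (t (l + 1)) := by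
  induction r with
  | zero => exact absurd h0 (not_le.mpr hr)
  | succ r ih =>
    by_cases h : x < t r
    · obtain ⟨l, hl, hx⟩ := ih h
      exact ⟨l, hl.trans r.lt_succ_self, hx⟩
    · exact ⟨r, r.lt_succ_self, not_lt.mp h, hr⟩

theorem PiecewiseLipschitzOn01.exists_bound {f : ℝ → ℝ} (hf : PiecewiseLipschitzOn01 f) :
    ∃ M : ℝ, 0 ≤ M ∧ ∀ x, |f x| ≤ M := by
  obtain ⟨h0, r, t, L, hL, -, ht0, htr, hlt, hlip⟩ := hf
  have hsum : 0 ≤ ∑ l ∈ Finset.range (r + 1), |f (t l)| :=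
    Finset.sum_nonneg fun _ _ => abs_nonneg _
  have hle : ∀ l ≤ r, |f (t l)| ≤ ∑ l ∈ Finset.range (r + 1), |f (t l)| := fun l hl =>
    Finset.single_le_sum (f := fun l => |f (t l)|) (fun _ _ => abs_nonneg _)
      (Finset.mem_range.mpr (by omega))
  refine ⟨∑ l ∈ Finset.range (r + 1), |f (t l)| + L, by positivity, fun x => ?_⟩
  by_cases hx : x ∈ Icc (0 : ℝ) 1
  · rcases hx.2.lt_or_eq with hx1 | rfl
    · obtain ⟨l, hl, hxl⟩ := exists_mem_Ico_step (t := t) r (ht0 ▸ hx.1) (htr ▸ hx1)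
      have hl0 : 0 ≤ t l := by
        have : ∀ n ≤ r, 0 ≤ t n := by
          intro n
          induction n with
          | zero => intro _; exact ht0.ge
          | succ n ih => intro hn; exact (ih (by omega)).trans (hlt n (by omega)).le
        exact this l hl.le
      have h1 := hlip l hl x hxl (t l) ⟨le_rfl, hlt l hl⟩
      have h2 : |x - t l| ≤ 1 := by
        rw [abs_of_nonneg (by linarith [hxl.1])]; linarith
      have h3 : L * |x - t l| ≤ L := mul_le_of_le_one_right hL h2
      have h4 := abs_sub_abs_le_abs_sub (f x) (f (t l))
      linarith [hle l hl.le]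
    · have := hle r le_rfl
      rw [htr] at this
      linarith
  · rw [h0 x hx, abs_zero]
    positivity

theorem PiecewiseLipschitzOn01.integrable {f : ℝ → ℝ} (hf : PiecewiseLipschitzOn01 f) :
    Integrable f := by
  obtain ⟨M, -, hM⟩ := hf.exists_bound
  obtain ⟨h0, r, t, L, hL, -, ht0, htr, hlt, hlip⟩ := hf
  have hpiece : ∀ l < r, IntervalIntegrable f volume (t l) (t (l + 1)) := by
    intro l hl
    have hcont : ContinuousOn f (Ico (t l) (t (l + 1))) :=
      (LipschitzOnWith.of_dist_le_mul (K := L.toNNReal) fun x hx y hy => by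
        simpa [Real.dist_eq, hL] using hlip l hl x hx y hy).continuousOn
    rw [intervalIntegrable_iff_integrableOn_Ico_of_le (hlt l hl).le]
    exact IntegrableOn.of_bound measure_Ico_lt_top
      (hcont.aestronglyMeasurable measurableSet_Ico) M (ae_of_all _ hM)
  have h01 := IntervalIntegrable.trans_iterate hpiece
  rw [ht0, htr, intervalIntegrable_iff_integrableOn_Icc_of_le zero_le_one] at h01
  exact (integrableOn_iff_integrable_of_support_subset fun x hx => by
    by_contra h; exact hx (h0 x h)).mp h01

/-- The oscillations over the cells `[j/k, (j+1)/k)` of a piecewise Lipschitz function have a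
sum bounded independently of `k`. -/
theorem PiecewiseLipschitzOn01.exists_oscillation_bound {f : ℝ → ℝ}
    (hf : PiecewiseLipschitzOn01 f) :
    ∃ V : ℝ, ∀ k : ℕ, 1 ≤ k → ∃ ω : ℤ → ℝ,
      (∀ j : ℤ, ∀ x ∈ Ico ((j : ℝ) / k) (((j : ℝ) + 1) / k), |f x - f ((j : ℝ) / k)| ≤ ω j) ∧
      ∀ s : Finset ℤ, ∑ j ∈ s, ω j ≤ V := by
  obtain ⟨M, hM0, hM⟩ := hf.exists_bound
  obtain ⟨h0, r, t, L, hL, -, ht0, htr, hlt, hlip⟩ := hf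
  refine ⟨L + (r + 1) * (2 * M), fun k hk => ?_⟩
  have hk0 : (0 : ℝ) < k := by exact_mod_cast hk
  refine ⟨fun j => (if j ∈ Finset.Ico (0 : ℤ) k then L / k else 0) +
    ∑ l ∈ Finset.range (r + 1), if ⌊t l * k⌋ = j then 2 * M else 0, ?_, ?_⟩
  · intro j x hx
    have hA : 0 ≤ (if j ∈ Finset.Ico (0 : ℤ) k then L / k else 0) := by
      split_ifs <;> positivity
    have hB : ∀ l ∈ Finset.range (r + 1), 0 ≤ (if ⌊t l * k⌋ = j then 2 * M else 0) := by
      intro l _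
      split_ifs <;> positivity
    by_cases hex : ∃ l ≤ r, ⌊t l * k⌋ = j
    · obtain ⟨l, hl, hlj⟩ := hex
      have h1 := Finset.single_le_sum hB (Finset.mem_range.mpr (Nat.lt_succ_of_le hl))
      rw [if_pos hlj] at h1
      have h2 := abs_sub (f x) (f ((j : ℝ) / k))
      linarith [hM x, hM ((j : ℝ) / k)]
    · have hnone : ∀ l ≤ r, t l ∉ Ico ((j : ℝ) / k) (((j : ℝ) + 1) / k) := by
        intro l hl hmem
        refine hex ⟨l, hl, Int.floor_eq_iff.mpr ⟨?_, ?_⟩⟩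
        · exact (div_le_iff₀ hk0).mp hmem.1
        · exact (lt_div_iff₀ hk0).mp hmem.2
      have hsum := Finset.sum_nonneg hB
      have hsmall : |f x - f ((j : ℝ) / k)| ≤
          (if j ∈ Finset.Ico (0 : ℤ) k then L / k else 0) := by
        have hzero : x ∉ Icc (0 : ℝ) 1 → (j : ℝ) / k ∉ Icc (0 : ℝ) 1 →
            |f x - f ((j : ℝ) / k)| ≤ (if j ∈ Finset.Ico (0 : ℤ) k then L / k else 0) := by
          intro h1 h2
          rwa [h0 x h1, h0 _ h2, sub_zero, abs_zero]
        rcases lt_or_ge j 0 with hj | hj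
        · have h1 : ((j : ℝ) + 1) / k ≤ 0 :=
            div_nonpos_of_nonpos_of_nonneg (by exact_mod_cast hj) hk0.le
          exact hzero (fun h => by linarith [h.1, hx.2]) (fun h => by linarith [h.1, hx.1, hx.2])
        have hj0 : (0 : ℝ) ≤ (j : ℝ) / k := div_nonneg (by exact_mod_cast hj) hk0.le
        rcases lt_or_ge ((j : ℝ) / k) 1 with hj1 | hj1
        · have hjk : j < k := by
            have := (div_lt_one hk0).mp hj1
            exact_mod_cast this
          rw [if_pos (Finset.mem_Ico.mpr ⟨hj, hjk⟩)]
          obtain ⟨l, hl, hjl⟩ := exists_mem_Ico_step (t := t) r (ht0 ▸ hj0) (htr ▸ hj1)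
          have hxl : x < t (l + 1) := by
            by_contra! h
            exact hnone (l + 1) hl ⟨hjl.2.le, h.trans_lt hx.2⟩
          refine (hlip l hl x ⟨hjl.1.trans hx.1, hxl⟩ _ hjl).trans ?_
          rw [div_eq_mul_one_div L]
          refine mul_le_mul_of_nonneg_left ?_ hL
          rw [abs_of_nonneg (by linarith [hx.1])]
          have := hx.2
          rw [add_div] at this
          linarith
        · have hne : (1 : ℝ) ≠ (j : ℝ) / k := fun h => hnone r le_rfl
            ⟨by rw [htr, h], by rw [htr]; exact (h.le.trans hx.1).trans_lt hx.2⟩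
          have hgt := lt_of_le_of_ne hj1 hne
          exact hzero (fun h => by linarith [h.2, hx.1]) (fun h => by linarith [h.2])
      linarith
  · intro s
    rw [Finset.sum_add_distrib, Finset.sum_comm]
    refine add_le_add ?_ ?_
    · rw [← Finset.sum_filter, Finset.sum_const, nsmul_eq_mul]
      have hcard : (s.filter (· ∈ Finset.Ico (0 : ℤ) k)).card ≤ k := by
        have := Finset.card_le_card (s := s.filter (· ∈ Finset.Ico (0 : ℤ) k))
          (t := Finset.Ico (0 : ℤ) k) fun j hj => (Finset.mem_filter.mp hj).2
        simpa using this
      calc _ ≤ (k : ℝ) * (L / k) := by gcongr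
        _ = L := by field_simp
    · have hone : ∀ l ∈ Finset.range (r + 1),
          ∑ j ∈ s, (if ⌊t l * k⌋ = j then 2 * M else 0) ≤ 2 * M := by
        intro l _
        rw [Finset.sum_ite_eq]
        split_ifs <;> linarith
      refine (Finset.sum_le_sum hone).trans ?_
      simp

/-- Left Riemann sums with mesh `1/k`, with the error controlled cell by cell. -/
theorem abs_riemannSum_sub_integral_le {g : ℝ → ℝ} {k : ℕ} (hk : 1 ≤ k) {a : ℤ} {n : ℕ}
    {ω : ℤ → ℝ} (hg : ∀ x y, IntervalIntegrable g volume x y)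
    (hω : ∀ i < n, ∀ x ∈ Ico (((a + i : ℤ) : ℝ) / k) ((((a + i : ℤ) : ℝ) + 1) / k),
      |g x - g (((a + i : ℤ) : ℝ) / k)| ≤ ω (a + i)) :
    |(1 / (k : ℝ)) * ∑ i ∈ Finset.range n, g (((a + i : ℤ) : ℝ) / k) -
      ∫ x in ((a : ℝ) / k)..(((a + n : ℤ) : ℝ) / k), g x| ≤
      (∑ i ∈ Finset.range n, ω (a + i)) / k := by
  have hk0 : (0 : ℝ) < k := by exact_mod_cast hk
  have hadj := intervalIntegral.sum_integral_adjacent_intervals (f := g) (μ := volume)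
    (a := fun i : ℕ => ((a + i : ℤ) : ℝ) / k) (n := n) fun _ _ => hg _ _
  simp only [Nat.cast_zero, add_zero] at hadj
  rw [← hadj, Finset.mul_sum, ← Finset.sum_sub_distrib, Finset.sum_div]
  refine (Finset.abs_sum_le_sum_abs _ _).trans (Finset.sum_le_sum fun i hi => ?_)
  set p : ℝ := ((a + i : ℤ) : ℝ) with hp
  have hp1 : ((a + (i + 1 : ℕ) : ℤ) : ℝ) = p + 1 := by rw [hp]; push_cast; ring
  rw [hp1]
  have hlen : (p + 1) / k - p / k = 1 / (k : ℝ) := by ring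
  have hconst : (1 / (k : ℝ)) * g (p / k) = ∫ _ in (p / k)..((p + 1) / k), g (p / k) := by
    rw [intervalIntegral.integral_const, hlen, smul_eq_mul]
  rw [hconst, abs_sub_comm, ← intervalIntegral.integral_sub (hg _ _) intervalIntegrable_const]
  have hle : p / k ≤ (p + 1) / k := by gcongr; linarith
  have hnorm : ‖∫ x in (p / k)..((p + 1) / k), (g x - g (p / k))‖ ≤
      ω (a + i) * |(p + 1) / k - p / k| := by
    refine intervalIntegral.norm_integral_le_of_norm_le_const_ae ?_
    filter_upwards [measure_eq_zero_iff_ae_notMem.mp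
      (measure_singleton (μ := volume) ((p + 1) / (k : ℝ)))] with x hx hxI
    rw [uIoc_of_le hle] at hxI
    exact hω i (Finset.mem_range.mp hi) x ⟨hxI.1.le, lt_of_le_of_ne hxI.2 hx⟩
  rw [hlen, abs_of_pos (by positivity), mul_one_div] at hnorm
  exact hnorm

theorem sum_int_Icc_add_natCast (F : ℤ → ℝ) (a : ℤ) (n : ℕ) :
    ∑ j ∈ Finset.Icc a (a + n), F j = ∑ i ∈ Finset.range (n + 1), F (a + i) := by
  refine Finset.sum_nbij' (fun j => (j - a).toNat) (fun i => a + i) ?_ ?_ ?_ ?_ ?_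
  · intro j hj; simp only [Finset.mem_Icc, Finset.mem_range] at *; omega
  · intro i hi; simp only [Finset.mem_Icc, Finset.mem_range] at *; omega
  · intro j hj; simp only [Finset.mem_Icc] at *; omega
  · intro i hi; simp
  · intro j hj
    simp only [Finset.mem_Icc] at hj
    congr 1; omega

theorem sum_range_int_le {ω : ℤ → ℝ} {V : ℝ} (hV : ∀ s : Finset ℤ, ∑ j ∈ s, ω j ≤ V)
    (a : ℤ) (n : ℕ) : ∑ i ∈ Finset.range n, ω (a + i) ≤ V := by
  have := hV ((Finset.range n).image fun i : ℕ => a + (i : ℤ))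
  rwa [Finset.sum_image fun i _ j _ h => by simpa using h] at this

/-- The window integral `y ↦ ∫_{y-1}^{y+1} f` of a function bounded by `M` is `2M`-Lipschitz. -/
theorem abs_window_integral_sub_le {f : ℝ → ℝ} {M : ℝ} (hf : Integrable f)
    (hM : ∀ x, |f x| ≤ M) (y z : ℝ) :
    |(∫ v in (y - 1)..(y + 1), f v) - ∫ v in (z - 1)..(z + 1), f v| ≤ 2 * M * |y - z| := by
  rw [intervalIntegral.integral_interval_sub_interval_comm hf.intervalIntegrable
    hf.intervalIntegrable hf.intervalIntegrable]
  have hb : ∀ p q : ℝ, |∫ v in p..q, f v| ≤ M * |q - p| := fun p q =>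
    (Real.norm_eq_abs _).ge.trans
      (intervalIntegral.norm_integral_le_of_norm_le_const fun x _ => hM x)
  have h1 := hb (y - 1) (z - 1)
  have h2 := hb (y + 1) (z + 1)
  rw [show z - 1 - (y - 1) = z - y by ring, abs_sub_comm] at h1
  rw [show z + 1 - (y + 1) = z - y by ring, abs_sub_comm] at h2
  have h3 := abs_sub (∫ v in (y - 1)..(z - 1), f v) (∫ v in (y + 1)..(z + 1), f v)
  linarith

theorem abs_windowSum_sub_integral_le {f : ℝ → ℝ} {M V : ℝ} (hf : Integrable f)
    (hM : ∀ x, |f x| ≤ M) {k : ℕ} (hk : 1 ≤ k) {ω : ℤ → ℝ}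
    (hω : ∀ j : ℤ, ∀ x ∈ Ico ((j : ℝ) / k) (((j : ℝ) + 1) / k), |f x - f ((j : ℝ) / k)| ≤ ω j)
    (hV : ∀ s : Finset ℤ, ∑ j ∈ s, ω j ≤ V) (p : ℤ) :
    |(1 / (k : ℝ)) * ∑ j ∈ Finset.Icc (p - k) (p + k), f ((j : ℝ) / k) -
      ∫ v in ((p : ℝ) / k - 1)..((p : ℝ) / k + 1), f v| ≤ (V + M) / k := by
  have hk0 : (0 : ℝ) < k := by exact_mod_cast hk
  have hR := abs_riemannSum_sub_integral_le (g := f) hk (a := p - k) (n := 2 * k) (ω := ω)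
    (fun _ _ => hf.intervalIntegrable) fun i _ => hω _
  have hend : p + k = p - k + ((2 * k : ℕ) : ℤ) := by push_cast; ring
  have e1 : ((p - k : ℤ) : ℝ) / k = (p : ℝ) / k - 1 := by push_cast; field_simp
  have e2 : ((p - k + ((2 * k : ℕ) : ℤ) : ℤ) : ℝ) / k = (p : ℝ) / k + 1 := by
    rw [← hend]; push_cast; field_simp
  rw [e1, e2] at hR
  rw [hend, sum_int_Icc_add_natCast, Finset.sum_range_succ, mul_add, e2, add_sub_right_comm]
  have hlast : |(1 / (k : ℝ)) * f ((p : ℝ) / k + 1)| ≤ M / k := by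
    rw [abs_mul, abs_of_pos (by positivity), one_div_mul_eq_div]
    gcongr
    exact hM _
  have hRV := hR.trans (div_le_div_of_nonneg_right (sum_range_int_le hV _ _) hk0.le)
  rw [add_div]
  exact (abs_add_le _ _).trans (add_le_add hRV hlast)

/-- for piecewise Lipschitz `α, β` supported in `[0,1]` there is `C`
(depending only on `α, β`) with
`|k⁻² ∑_{i=0}^{k−1} α(i/k) ∑_{j=m+i−k}^{m+i+k} β(j/k) − ψ_{α,β}(m/k)| ≤ C/k`
for every `k ≥ 1` and every `m ∈ ℤ`. -/
theorem stmt6 (α β : ℝ → ℝ)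
    (hα : PiecewiseLipschitzOn01 α) (hβ : PiecewiseLipschitzOn01 β) :
    ∃ C : ℝ, ∀ k : ℕ, 1 ≤ k → ∀ m : ℤ,
      |(1 / (k : ℝ) ^ 2) *
          (∑ i ∈ Finset.range k, α ((i : ℝ) / k) *
            ∑ j ∈ Finset.Icc (m + (i : ℤ) - (k : ℤ)) (m + (i : ℤ) + (k : ℤ)),
              β ((j : ℝ) / k)) -
        psi α β ((m : ℝ) / k)| ≤ C / k := by
  obtain ⟨A, hA0, hA⟩ := hα.exists_bound
  obtain ⟨M, hM0, hM⟩ := hβ.exists_bound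
  obtain ⟨V, hV⟩ := hα.exists_oscillation_bound
  obtain ⟨W, hW⟩ := hβ.exists_oscillation_bound
  refine ⟨A * (W + M) + (2 * M * V + 2 * A * M), fun k hk m => ?_⟩
  obtain ⟨ω, hω, hωV⟩ := hV k hk
  obtain ⟨η, hη, hηW⟩ := hW k hk
  have hk0 : (0 : ℝ) < k := by exact_mod_cast hk
  set B : ℝ → ℝ := fun y => ∫ v in (y - 1)..(y + 1), β v with hB
  have hBlip : ∀ y z, |B y - B z| ≤ 2 * M * |y - z| :=
    abs_window_integral_sub_le hβ.integrable hM
  have hBbound : ∀ y, |B y| ≤ 2 * M := by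
    intro y
    have h : |B y| ≤ M * |(y + 1) - (y - 1)| :=
      (Real.norm_eq_abs _).ge.trans
        (intervalIntegral.norm_integral_le_of_norm_le_const fun x _ => hM x)
    rw [show (y + 1) - (y - 1) = 2 by ring, abs_two] at h
    linarith
  have hBcont : Continuous B :=
    (LipschitzWith.of_dist_le_mul (K := (2 * M).toNNReal) fun y z => by
      rw [Real.coe_toNNReal _ (by positivity)]; exact hBlip y z).continuous
  set x : ℝ := (m : ℝ) / k with hx
  set g : ℝ → ℝ := fun u => α u * B (x + u) with hg
  have hgint : ∀ p q, IntervalIntegrable g volume p q := fun p q =>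
    hα.integrable.intervalIntegrable.mul_continuousOn
      (hBcont.comp (continuous_const.add continuous_id)).continuousOn
  have hgω : ∀ j : ℤ, ∀ u ∈ Ico ((j : ℝ) / k) (((j : ℝ) + 1) / k),
      |g u - g ((j : ℝ) / k)| ≤ ω j * (2 * M) + A * (2 * M * (1 / k)) := by
    intro j u hu
    have hsplit : g u - g ((j : ℝ) / k) = (α u - α ((j : ℝ) / k)) * B (x + u) +
        α ((j : ℝ) / k) * (B (x + u) - B (x + (j : ℝ) / k)) := by
      simp only [hg]; ring
    have hdist : |x + u - (x + (j : ℝ) / k)| ≤ 1 / k := by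
      have := hu.2
      rw [add_div] at this
      rw [abs_of_nonneg (by linarith [hu.1])]
      linarith
    rw [hsplit]
    refine (abs_add_le _ _).trans ?_
    rw [abs_mul, abs_mul]
    have hω0 := (abs_nonneg _).trans (hω j u hu)
    refine add_le_add (mul_le_mul (hω j u hu) (hBbound _) (abs_nonneg _) hω0)
      (mul_le_mul (hA _) ((hBlip _ _).trans ?_) (abs_nonneg _) hA0)
    gcongr
  have hR := abs_riemannSum_sub_integral_le (g := g) hk (a := 0) (n := k)
    (ω := fun j => ω j * (2 * M) + A * (2 * M * (1 / k))) hgint fun i _ => hgω _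
  have hRbound : ∑ i ∈ Finset.range k, (ω (0 + i) * (2 * M) + A * (2 * M * (1 / k))) ≤
      2 * M * V + 2 * A * M := by
    rw [Finset.sum_add_distrib, ← Finset.sum_mul, Finset.sum_const, Finset.card_range,
      nsmul_eq_mul]
    have h1 := mul_le_mul_of_nonneg_right (sum_range_int_le hωV 0 k)
      (by positivity : 0 ≤ 2 * M)
    have h2 : (k : ℝ) * (A * (2 * M * (1 / k))) = 2 * A * M := by field_simp
    linarith
  have hpsi : psi α β x = ∫ u in (0 : ℝ)..1, g u := rfl
  have hR' := hR.trans (div_le_div_of_nonneg_right hRbound hk0.le)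
  simp only [zero_add, Int.cast_natCast, Int.cast_zero, zero_div, div_self hk0.ne', ← hpsi] at hR'
  have hS : |(1 / (k : ℝ) ^ 2) * (∑ i ∈ Finset.range k, α ((i : ℝ) / k) *
      ∑ j ∈ Finset.Icc (m + (i : ℤ) - (k : ℤ)) (m + (i : ℤ) + (k : ℤ)), β ((j : ℝ) / k)) -
      (1 / (k : ℝ)) * ∑ i ∈ Finset.range k, g ((i : ℝ) / k)| ≤ A * (W + M) / k := by
    have hrew : (1 / (k : ℝ) ^ 2) * (∑ i ∈ Finset.range k, α ((i : ℝ) / k) *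
        ∑ j ∈ Finset.Icc (m + (i : ℤ) - (k : ℤ)) (m + (i : ℤ) + (k : ℤ)), β ((j : ℝ) / k)) -
        (1 / (k : ℝ)) * ∑ i ∈ Finset.range k, g ((i : ℝ) / k) =
        (1 / (k : ℝ)) * ∑ i ∈ Finset.range k, α ((i : ℝ) / k) *
          ((1 / (k : ℝ)) * ∑ j ∈ Finset.Icc (m + (i : ℤ) - (k : ℤ)) (m + (i : ℤ) + (k : ℤ)),
            β ((j : ℝ) / k) - B (((m + i : ℤ) : ℝ) / k)) := by
      simp only [mul_sub, Finset.sum_sub_distrib, hg, hx]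
      congr 1
      · rw [Finset.mul_sum, Finset.mul_sum]
        refine Finset.sum_congr rfl fun i _ => ?_
        ring
      · congr 1
        refine Finset.sum_congr rfl fun i _ => ?_
        push_cast
        rw [add_div]
    rw [hrew, abs_mul, abs_of_pos (by positivity)]
    have hterm : ∀ i ∈ Finset.range k, |α ((i : ℝ) / k) *
        ((1 / (k : ℝ)) * ∑ j ∈ Finset.Icc (m + (i : ℤ) - (k : ℤ)) (m + (i : ℤ) + (k : ℤ)),
          β ((j : ℝ) / k) - B (((m + i : ℤ) : ℝ) / k))| ≤ A * ((W + M) / k) := by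
      intro i _
      rw [abs_mul]
      exact mul_le_mul (hA _)
        (abs_windowSum_sub_integral_le hβ.integrable hM hk hη hηW (m + i)) (abs_nonneg _) hA0
    have hsum := (Finset.abs_sum_le_sum_abs _ _).trans (Finset.sum_le_sum hterm)
    rw [Finset.sum_const, Finset.card_range, nsmul_eq_mul] at hsum
    refine (mul_le_mul_of_nonneg_left hsum (by positivity)).trans_eq ?_
    field_simp
  rw [add_div]
  exact (abs_sub_le _ _ _).trans (add_le_add hS hR')
end

section
/- For bounded measurable α : ℝ → ℝ vanishing outside [0,1], the function ψ_{α,α} is even, i.e. ψ_{α,α}(−x) = ψ_{α,α}(x) for all x. Moreover, if α(x) = ∫_0^x h(v) dv for some bounded measurable h vanishing outside [0,1] with ∫_0^1 h(v) dv = 0, then ψ_{α,h} and ψ_{h,α} are odd functions on ℝ. -/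
open Filter Set MeasureTheory

lemma integrable_of_bounded_of_eq_zero_off_Icc {f : ℝ → ℝ} (hfm : Measurable f)
    (hfb : ∃ M : ℝ, ∀ x, |f x| ≤ M) (hf0 : ∀ x, x ∉ Set.Icc (0:ℝ) 1 → f x = 0) :
    Integrable f := by
  obtain ⟨M, hM⟩ := hfb
  have h : IntegrableOn f (Set.Icc (0:ℝ) 1) :=
    Measure.integrableOn_of_bounded (M := M) measure_Icc_lt_top.ne hfm.aestronglyMeasurable
      (Eventually.of_forall hM)
  exact h.integrable_of_forall_notMem_eq_zero hf0

lemma psi_eq_integral {α : ℝ → ℝ} (hα0 : ∀ x, x ∉ Set.Icc (0:ℝ) 1 → α x = 0)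
    (β : ℝ → ℝ) (x : ℝ) :
    psi α β x = ∫ u, α u * ∫ v in (x + u - 1)..(x + u + 1), β v := by
  rw [psi, intervalIntegral.integral_of_le zero_le_one, ← integral_Icc_eq_integral_Ioc]
  exact setIntegral_eq_integral_of_forall_compl_eq_zero fun u hu => by simp [hα0 u hu]

/-- Reflecting the argument of `psi` swaps the two functions. -/
lemma psi_neg {α β : ℝ → ℝ} (hα : Integrable α) (hβ : Integrable β)
    (hα0 : ∀ x, x ∉ Set.Icc (0:ℝ) 1 → α x = 0) (hβ0 : ∀ x, x ∉ Set.Icc (0:ℝ) 1 → β x = 0)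
    (x : ℝ) : psi α β (-x) = psi β α x := by
  rw [psi_eq_integral hα0, psi_eq_integral hβ0]
  let S : Set (ℝ × ℝ) := {p | -x + p.1 - 1 < p.2} ∩ {p | p.2 ≤ -x + p.1 + 1}
  have hS : MeasurableSet S :=
    (measurableSet_lt (by fun_prop) (by fun_prop)).inter
      (measurableSet_le (by fun_prop) (by fun_prop))
  have hint : Integrable (S.indicator fun p : ℝ × ℝ => α p.1 * β p.2)
      ((volume : Measure ℝ).prod volume) :=
    (hα.mul_prod hβ).indicator hS
  have h1 (u : ℝ) : α u * ∫ v in (-x + u - 1)..(-x + u + 1), β v =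
      ∫ v, S.indicator (fun p : ℝ × ℝ => α p.1 * β p.2) (u, v) := by
    rw [intervalIntegral.integral_of_le (by linarith), ← integral_const_mul,
      ← integral_indicator measurableSet_Ioc]
    rfl
  have h2 (v : ℝ) : β v * ∫ u in (x + v - 1)..(x + v + 1), α u =
      ∫ u, S.indicator (fun p : ℝ × ℝ => α p.1 * β p.2) (u, v) := by
    rw [intervalIntegral.integral_of_le (by linarith), ← integral_Ico_eq_integral_Ioc,
      ← integral_const_mul, ← integral_indicator measurableSet_Ico]
    congr 1 with u
    have : u ∈ Set.Ico (x + v - 1) (x + v + 1) ↔ (u, v) ∈ S := by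
      simp only [S, Set.mem_Ico, Set.mem_inter_iff, Set.mem_ofPred_eq]
      constructor <;> rintro ⟨h, h'⟩ <;> constructor <;> linarith
    simp only [Set.indicator_apply, this, mul_comm]
  simp_rw [h1, h2]
  exact integral_integral_swap hint

lemma psi_primitive_neg {α h : ℝ → ℝ} (hα : Integrable α) (hαm : Measurable α)
    (hαb : ∃ M : ℝ, ∀ x, |α x| ≤ M) (hα0 : ∀ x, x ∉ Set.Icc (0:ℝ) 1 → α x = 0)
    (hh : Integrable h) (hαh : ∀ x : ℝ, α x = ∫ v in (0:ℝ)..x, h v) (x : ℝ) :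
    psi α h (-x) = - psi α h x := by
  obtain ⟨M, hM⟩ := hαb
  have hprod (c : ℝ) : Integrable fun u => α u * α (u + c) :=
    hα.mul_bdd (c := M) (hαm.comp (measurable_add_const c)).aestronglyMeasurable
      (Eventually.of_forall fun u => hM _)
  have hpsi (y : ℝ) : psi α h y =
      (∫ u, α u * α (u + (y + 1))) - ∫ u, α u * α (u + (y - 1)) := by
    rw [psi_eq_integral hα0, ← integral_sub (hprod _) (hprod _)]
    congr 1 with u
    rw [← mul_sub, hαh (u + (y + 1)), hαh (u + (y - 1)),
      intervalIntegral.integral_interval_sub_left hh.intervalIntegrable hh.intervalIntegrable]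
    ring_nf
  have hshift (c : ℝ) : ∫ u, α u * α (u + -c) = ∫ u, α u * α (u + c) := by
    rw [← integral_add_right_eq_self _ c]
    congr 1 with u
    rw [add_neg_cancel_right, mul_comm]
  rw [hpsi, hpsi, show -x + 1 = -(x - 1) by ring, show -x - 1 = -(x + 1) by ring,
    hshift, hshift, neg_sub]

/-- for bounded measurable `α` vanishing outside `[0,1]`, `ψ_{α,α}` is
even; moreover, if `α(x) = ∫_0^x h(v) dv` for some bounded measurable `h` vanishing
outside `[0,1]` with `∫_0^1 h = 0`, then `ψ_{α,h}` and `ψ_{h,α}` are odd. -/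
theorem stmt11 (α : ℝ → ℝ)
    (hαm : Measurable α) (hαb : ∃ M : ℝ, ∀ x, |α x| ≤ M)
    (hα0 : ∀ x, x ∉ Set.Icc (0:ℝ) 1 → α x = 0) :
    (∀ x : ℝ, psi α α (-x) = psi α α x) ∧
    (∀ h : ℝ → ℝ, Measurable h → (∃ M : ℝ, ∀ x, |h x| ≤ M) →
      (∀ x, x ∉ Set.Icc (0:ℝ) 1 → h x = 0) →
      (∫ v in (0:ℝ)..1, h v) = 0 →
      (∀ x : ℝ, α x = ∫ v in (0:ℝ)..x, h v) →
      (∀ x : ℝ, psi α h (-x) = - psi α h x) ∧ (∀ x : ℝ, psi h α (-x) = - psi h α x)) := by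
  have hα := integrable_of_bounded_of_eq_zero_off_Icc hαm hαb hα0
  refine ⟨psi_neg hα hα hα0 hα0, fun h hhm hhb hh0 _ hαh => ?_⟩
  have hh := integrable_of_bounded_of_eq_zero_off_Icc hhm hhb hh0
  have hodd := psi_primitive_neg hα hαm hαb hα0 hh hαh
  refine ⟨hodd, fun x => ?_⟩
  rw [psi_neg hh hα hh0 hα0, ← psi_neg hα hh hα0 hh0 x, hodd, neg_neg]
end

section
/- Let h : ℝ → ℝ be bounded measurable, vanishing outside [0,1], with ∫_0^1 h(v) dv = 0, and define g(x) = ∫_0^x h(v) dv (so g is continuous and vanishes outside [0,1]). Then ∫_{−2}^{2} ψ_{h,h}(x) ψ_{g,g}(x) dx = ∫_{−2}^{2} ψ_{g,h}(x)² dx. -/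
open Filter Set MeasureTheory

/-- The derivative of the integral of a continuous function over a moving window. -/
theorem hasDerivAt_integral_window {β : ℝ → ℝ} (hβ : Continuous β) (y : ℝ) :
    HasDerivAt (fun y => ∫ v in (y - 1)..(y + 1), β v) (β (y + 1) - β (y - 1)) y := by
  have primitive (y : ℝ) : HasDerivAt (fun y => ∫ v in (0:ℝ)..y, β v) (β y) y :=
    hβ.integral_hasStrictDerivAt 0 y |>.hasDerivAt
  have hβi (a b : ℝ) : IntervalIntegrable β volume a b := hβ.intervalIntegrable a b
  rw [funext fun y =>
    (intervalIntegral.integral_interval_sub_left (hβi 0 (y + 1)) (hβi 0 (y - 1))).symm]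
  exact ((primitive (y + 1)).comp_add_const y 1).sub ((primitive (y - 1)).comp_sub_const y 1)

/-- Differentiation of a windowed correlation with a continuous kernel: the derivative of
`psi α β` is the correlation of `α` with the increments of `β`. -/
theorem hasDerivAt_psi {α β : ℝ → ℝ} (hα : Measurable α) {A : ℝ} (hαA : ∀ x, |α x| ≤ A)
    (hβ : Continuous β) {B : ℝ} (hβB : ∀ x, |β x| ≤ B) (x : ℝ) :
    HasDerivAt (psi α β) (∫ u in (0:ℝ)..1, α u * (β (x + u + 1) - β (x + u - 1))) x := by
  have window_cont (y : ℝ) : Continuous fun u => ∫ v in (y + u - 1)..(y + u + 1), β v :=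
    (continuous_iff_continuousAt.2 fun y => (hasDerivAt_integral_window hβ y).continuousAt).comp
      (continuous_const_add y)
  have hα_int : IntervalIntegrable α volume 0 1 :=
    (intervalIntegrable_const (c := A)).mono_fun hα.aestronglyMeasurable
      (ae_of_all _ fun t => (hαA t).trans (le_abs_self A))
  have hA : 0 ≤ A := (abs_nonneg _).trans (hαA 0)
  refine (intervalIntegral.hasDerivAt_integral_of_dominated_loc_of_deriv_le
    (F := fun x u => α u * ∫ v in (x + u - 1)..(x + u + 1), β v)
    (F' := fun x u => α u * (β (x + u + 1) - β (x + u - 1)))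
    (bound := fun _ => A * (B + B)) (s := univ) Filter.univ_mem ?_ ?_ ?_ ?_ ?_ ?_).2
  · exact Eventually.of_forall fun y =>
      (hα.mul (window_cont y).measurable).aestronglyMeasurable
  · exact hα_int.mul_continuousOn (window_cont x).continuousOn
  · exact Measurable.aestronglyMeasurable (by fun_prop)
  · refine ae_of_all _ fun t _ y _ => ?_
    rw [Real.norm_eq_abs, abs_mul]
    exact mul_le_mul (hαA t) ((abs_sub _ _).trans (add_le_add (hβB _) (hβB _)))
      (abs_nonneg _) hA
  · exact intervalIntegrable_const
  · exact ae_of_all _ fun t _ y _ =>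
      ((hasDerivAt_integral_window hβ (y + t)).comp_add_const y t).const_mul (α t)

/-- Integration by parts between the primitive of an interval integrable function, vanishing at
both ends of the interval, and a continuously differentiable function. -/
theorem integral_primitive_mul_deriv {h W w : ℝ → ℝ}
    (hh : IntervalIntegrable h volume 0 1) (h_zero : ∫ v in (0:ℝ)..1, h v = 0)
    (hW : ∀ u, HasDerivAt W (w u) u) (hw : Continuous w) :
    ∫ u in (0:ℝ)..1, (∫ v in (0:ℝ)..u, h v) * w u = -∫ u in (0:ℝ)..1, h u * W u := by
  have hdW : deriv W = w := funext fun u => (hW u).deriv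
  have hWc : ContDiff ℝ 1 W :=
    contDiff_one_iff_deriv.2 ⟨fun u => (hW u).differentiableAt, hdW ▸ hw⟩
  have key := (hh.absolutelyContinuousOnInterval_intervalIntegral
    (c := 0) left_mem_uIcc).integral_mul_deriv_eq_deriv_mul
    (hWc.contDiffOn.absolutelyContinuousOnInterval)
  have hderiv : ∫ u in (0:ℝ)..1, deriv (fun y => ∫ v in (0:ℝ)..y, h v) u * W u
      = ∫ u in (0:ℝ)..1, h u * W u := by
    refine intervalIntegral.integral_congr_ae ?_
    filter_upwards [hh.ae_hasDerivAt_integral] with u hu hu_mem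
    rw [(hu (uIoc_subset_uIcc hu_mem) 0 left_mem_uIcc).deriv]
  rw [hderiv, hdW] at key
  simpa [h_zero] using key

/-- with `h` bounded measurable vanishing outside `[0,1]`, `∫_0^1 h = 0`
and `g(x) = ∫_0^x h(v) dv`, one has
`∫_{−2}^{2} ψ_{h,h}(x) ψ_{g,g}(x) dx = ∫_{−2}^{2} ψ_{g,h}(x)² dx`. -/
theorem stmt12 (h g : ℝ → ℝ)
    (hhm : Measurable h) (hhb : ∃ M : ℝ, ∀ x, |h x| ≤ M)
    (hh0 : ∀ x, x ∉ Set.Icc (0:ℝ) 1 → h x = 0)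
    (hhint : (∫ v in (0:ℝ)..1, h v) = 0)
    (hg : ∀ x : ℝ, g x = ∫ v in (0:ℝ)..x, h v) :
    ∫ x in (-2:ℝ)..2, psi h h x * psi g g x = ∫ x in (-2:ℝ)..2, (psi g h x) ^ 2 := by
  obtain ⟨M, hM⟩ := hhb
  have hi (a b : ℝ) : IntervalIntegrable h volume a b :=
    (intervalIntegrable_const (c := M)).mono_fun hhm.aestronglyMeasurable
      (ae_of_all _ fun t => (hM t).trans (le_abs_self M))
  have g_cont : Continuous g := by
    rw [funext hg]
    exact intervalIntegral.continuous_primitive hi 0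
  have window (y : ℝ) : ∫ v in (y - 1)..(y + 1), h v = g (y + 1) - g (y - 1) := by
    rw [hg, hg, intervalIntegral.integral_interval_sub_left (hi _ _) (hi _ _)]
  have g_left {x : ℝ} (hx : x ≤ 0) : g x = 0 := by
    rw [hg]
    refine intervalIntegral.integral_zero_ae ?_
    filter_upwards [Measure.ae_ne volume (0:ℝ)] with t ht ht_mem
    rw [uIoc_of_ge hx] at ht_mem
    exact hh0 t fun hc => ht (le_antisymm ht_mem.2 hc.1)
  have g_right {x : ℝ} (hx : 1 ≤ x) : g x = 0 := by
    rw [hg, ← intervalIntegral.integral_add_adjacent_intervals (hi 0 1) (hi 1 x), hhint, zero_add]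
    refine intervalIntegral.integral_zero_ae (ae_of_all _ fun t ht => ?_)
    rw [uIoc_of_le hx] at ht
    exact hh0 t fun hc => absurd hc.2 (not_le.2 ht.1)
  have hM0 : 0 ≤ M := (abs_nonneg _).trans (hM 0)
  have g_bound (x : ℝ) : |g x| ≤ M := by
    rcases le_total x 0 with hx | hx
    · simpa [g_left hx] using hM0
    rcases le_total 1 x with hx' | hx'
    · simpa [g_right hx'] using hM0
    have := intervalIntegral.norm_integral_le_of_norm_le_const (a := 0) (b := x) (f := h) (C := M)
      fun t _ => hM t
    rw [← hg, Real.norm_eq_abs, sub_zero, abs_of_nonneg hx] at this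
    exact this.trans (mul_le_of_le_one_right hM0 hx')
  have psi_h (α : ℝ → ℝ) (x : ℝ) :
      psi α h x = ∫ u in (0:ℝ)..1, α u * (g (x + u + 1) - g (x + u - 1)) := by
    simp_rw [psi, window]
  have deriv_gg (x : ℝ) : HasDerivAt (psi g g) (psi g h x) x := by
    rw [psi_h]
    exact hasDerivAt_psi g_cont.measurable g_bound g_cont g_bound x
  have deriv_hg (x : ℝ) : HasDerivAt (psi h g) (psi h h x) x := by
    rw [psi_h]
    exact hasDerivAt_psi hhm hM g_cont g_bound x
  have psi_gh (x : ℝ) : psi g h x = -psi h g x := by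
    rw [psi_h, psi]
    have hW (u : ℝ) : HasDerivAt (fun u => ∫ v in (x + u - 1)..(x + u + 1), g v)
        (g (x + u + 1) - g (x + u - 1)) u :=
      (hasDerivAt_integral_window g_cont (x + u)).comp_const_add x u
    have := integral_primitive_mul_deriv (hi 0 1) hhint hW (by fun_prop)
    simp_rw [← hg] at this
    exact this
  have hh_cont : Continuous (psi h h) := by
    rw [funext (psi_h h)]
    refine intervalIntegral.continuous_of_dominated_interval (bound := fun _ => M * (M + M))
      (fun x => Measurable.aestronglyMeasurable (by fun_prop)) (fun x => ae_of_all _ fun t _ => ?_)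
      intervalIntegrable_const (ae_of_all _ fun t _ => by fun_prop)
    rw [Real.norm_eq_abs, abs_mul]
    exact mul_le_mul (hM t) ((abs_sub _ _).trans (add_le_add (g_bound _) (g_bound _)))
      (abs_nonneg _) hM0
  have hg_cont : Continuous (psi h g) :=
    continuous_iff_continuousAt.2 fun x => (deriv_hg x).continuousAt
  have gh_cont : Continuous (psi g h) := by
    rw [funext psi_gh]
    exact hg_cont.neg
  have gh_two : psi g h 2 = 0 := by
    rw [psi_h]
    refine intervalIntegral.integral_zero_ae (ae_of_all _ fun u hu => ?_)
    rw [uIoc_of_le zero_le_one] at hu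
    rw [g_right (x := 2 + u + 1) (by linarith [hu.1]),
      g_right (x := 2 + u - 1) (by linarith [hu.1]), sub_zero, mul_zero]
  have gh_neg_two : psi g h (-2) = 0 := by
    rw [psi_h]
    refine intervalIntegral.integral_zero_ae (ae_of_all _ fun u hu => ?_)
    rw [uIoc_of_le zero_le_one] at hu
    rw [g_left (x := -2 + u + 1) (by linarith [hu.2]),
      g_left (x := -2 + u - 1) (by linarith [hu.2]), sub_zero, mul_zero]
  have parts := intervalIntegral.integral_mul_deriv_eq_deriv_mul (a := -2) (b := 2)
    (fun x _ => deriv_gg x) (fun x _ => deriv_hg x)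
    (gh_cont.intervalIntegrable _ _) (hh_cont.intervalIntegrable _ _)
  have hg_eq (x : ℝ) : psi h g x = -psi g h x := by rw [psi_gh, neg_neg]
  simp_rw [hg_eq, gh_two, gh_neg_two] at parts
  simpa [mul_comm, sq] using parts
end

section
/- Let t > 0 and let x : [0,t] → ℝ be bounded measurable. For each n ∈ ℕ let x_n : [0,t] → ℝ be measurable, and assume: (i) sup_n sup_{s∈[0,t]} |x_n(s)| < ∞; (ii) ∫_0^t x_n(s) ds → ∫_0^t x(s) ds as n → ∞; (iii) for every η > 0 there exists δ > 0 such that for every n there are finitely many points 0 = u_0 < u_1 < ⋯ < u_r = t with u_i − u_{i−1} ≥ δ for all i < r and with the oscillation sup_{s,v ∈ [u_{i−1},u_i)} |x_n(s) − x_n(v)| ≤ η for each i = 1, …, r. Suppose that for each n there are points 0 = s^n_0 < s^n_1 < ⋯ < s^n_{K_n} = t with max_i (s^n_i − s^n_{i−1}) → 0 as n → ∞. Then ∑_{i=1}^{K_n} x_n(s^n_{i−1}) (s^n_i − s^n_{i−1}) → ∫_0^t x(s) ds as n → ∞. -/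
open Filter Set MeasureTheory

/-- A real number between the first and last points of a finite sequence lies in one of the
half-open intervals between consecutive points. -/
theorem exists_mem_Ico_succ {u : ℕ → ℝ} {r : ℕ} {s : ℝ} (h0 : u 0 ≤ s) (hr : s < u r) :
    ∃ j < r, s ∈ Ico (u j) (u (j + 1)) := by
  induction r with
  | zero => exact absurd hr (not_lt.mpr h0)
  | succ r ih =>
    by_cases h : s < u r
    · obtain ⟨j, hj, hs⟩ := ih h
      exact ⟨j, hj.trans (Nat.lt_succ_self r), hs⟩
    · exact ⟨r, Nat.lt_succ_self r, not_lt.mp h, hr⟩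

/-- Gaps bounded below by `δ` accumulate linearly. -/
theorem natCast_mul_le_sub_of_le_gap {u : ℕ → ℝ} {δ : ℝ} {k : ℕ}
    (h : ∀ i < k, δ ≤ u (i + 1) - u i) : k * δ ≤ u k - u 0 := by
  rw [← Finset.sum_range_sub]
  simpa using Finset.card_nsmul_le_sum (Finset.range k) _ δ
    fun i hi => h i (Finset.mem_range.mp hi)

theorem le_of_lt_succ_of_le {p : ℕ → ℝ} {K : ℕ} (h : ∀ i < K, p i < p (i + 1)) {i j : ℕ}
    (hij : i ≤ j) (hj : j ≤ K) : p i ≤ p j := by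
  induction j, hij using Nat.le_induction with
  | base => exact le_rfl
  | succ j _ ih => exact (ih (by omega)).trans (h j (by omega)).le

theorem intervalIntegrable_of_measurable_of_abs_le {f : ℝ → ℝ} {a b M : ℝ} (hab : a ≤ b)
    (hf : Measurable f) (hM : ∀ s ∈ Icc a b, |f s| ≤ M) : IntervalIntegrable f volume a b := by
  rw [intervalIntegrable_iff_integrableOn_Icc_of_le hab]
  refine Measure.integrableOn_of_bounded (M := M) (by simp) hf.aestronglyMeasurable ?_
  exact (ae_restrict_iff' measurableSet_Icc).mpr (Eventually.of_forall hM)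

theorem intervalIntegrable_indicator_Icc_one (a b c d : ℝ) :
    IntervalIntegrable ((Icc a b).indicator fun _ => (1 : ℝ)) volume c d :=
  ((integrable_indicator_iff measurableSet_Icc).mpr (by simp)).intervalIntegrable

theorem integral_indicator_Icc_one_le {a ε c d : ℝ} (hcd : c ≤ d) (hε : 0 ≤ ε) :
    ∫ s in c..d, (Icc a (a + ε)).indicator (fun _ => (1 : ℝ)) s ≤ ε := by
  have hi : Integrable ((Icc a (a + ε)).indicator fun _ => (1 : ℝ)) :=
    (integrable_indicator_iff measurableSet_Icc).mpr (by simp)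
  rw [intervalIntegral.integral_of_le hcd]
  refine (setIntegral_le_integral hi (Eventually.of_forall fun s =>
    indicator_nonneg (fun _ _ => zero_le_one) s)).trans ?_
  simp [integral_indicator measurableSet_Icc, hε]

/-- If `f` oscillates by at most `η` on each piece of a partition of `[0, t]` by `u`, then
moving left by at most `ε` changes `f` by at most `η`, except within `ε` to the right of a
partition point. -/
theorem abs_sub_le_add_sum_indicator {f : ℝ → ℝ} {t M η ε : ℝ} {r : ℕ} {u : ℕ → ℝ}
    (hη : 0 ≤ η) (hM : ∀ s ∈ Icc 0 t, |f s| ≤ M) (hu0 : u 0 = 0) (hur : u r = t)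
    (hosc : ∀ i < r, ∀ s ∈ Ico (u i) (u (i + 1)), ∀ v ∈ Ico (u i) (u (i + 1)),
      |f s - f v| ≤ η)
    {a s : ℝ} (ha : 0 ≤ a) (has : a ≤ s) (hsa : s ≤ a + ε) (hst : s < t) :
    |f a - f s| ≤ η + 2 * M *
      ∑ j ∈ Finset.range r, (Icc (u j) (u j + ε)).indicator (fun _ => (1 : ℝ)) s := by
  have hfa := hM a ⟨ha, has.trans hst.le⟩
  have hfs := hM s ⟨ha.trans has, hst.le⟩
  have hM0 : 0 ≤ M := (abs_nonneg _).trans hfa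
  have hnn : ∀ j ∈ Finset.range r,
      0 ≤ (Icc (u j) (u j + ε)).indicator (fun _ => (1 : ℝ)) s :=
    fun j _ => indicator_nonneg (fun _ _ => zero_le_one) s
  obtain ⟨j, hj, hs⟩ := exists_mem_Ico_succ (hu0.trans_le (ha.trans has)) (hst.trans_eq hur.symm)
  by_cases hja : u j ≤ a
  · have := hosc j hj a ⟨hja, has.trans_lt hs.2⟩ s hs
    have := mul_nonneg (mul_nonneg zero_le_two hM0) (Finset.sum_nonneg hnn)
    linarith
  · have hone := Finset.single_le_sum hnn (Finset.mem_range.mpr hj)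
    rw [indicator_of_mem (show s ∈ Icc (u j) (u j + ε) from ⟨hs.1, by linarith⟩)] at hone
    have := mul_le_mul_of_nonneg_left hone (mul_nonneg zero_le_two hM0)
    have := abs_sub (f a) (f s)
    linarith

/-- Error bound for left-endpoint Riemann sums of a function oscillating by at most `η` on each
of the `r` pieces of a partition. -/
theorem abs_riemannSum_sub_integral_le_s15 {f : ℝ → ℝ} {t M η ε : ℝ} (ht : 0 ≤ t)
    (hf : Measurable f) (hη : 0 ≤ η) (hε : 0 ≤ ε) (hM : ∀ s ∈ Icc 0 t, |f s| ≤ M)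
    {r : ℕ} {u : ℕ → ℝ} (hu0 : u 0 = 0) (hur : u r = t)
    (hosc : ∀ i < r, ∀ s ∈ Ico (u i) (u (i + 1)), ∀ v ∈ Ico (u i) (u (i + 1)),
      |f s - f v| ≤ η)
    {K : ℕ} {p : ℕ → ℝ} (hp0 : p 0 = 0) (hpK : p K = t) (hp : ∀ i < K, p i < p (i + 1))
    (hmesh : ∀ i < K, p (i + 1) - p i ≤ ε) :
    |∑ i ∈ Finset.range K, f (p i) * (p (i + 1) - p i) - ∫ s in (0 : ℝ)..t, f s|
      ≤ η * t + 2 * M * (r * ε) := by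
  have hM0 : 0 ≤ M := (abs_nonneg _).trans (hM 0 ⟨le_rfl, ht⟩)
  have hpnn : ∀ i ≤ K, 0 ≤ p i := fun i hi => hp0 ▸ le_of_lt_succ_of_le hp (Nat.zero_le i) hi
  have hpt : ∀ i ≤ K, p i ≤ t := fun i hi => hpK ▸ le_of_lt_succ_of_le hp hi le_rfl
  have hfi : ∀ i < K, IntervalIntegrable f volume (p i) (p (i + 1)) := fun i hi =>
    intervalIntegrable_of_measurable_of_abs_le (hp i hi).le hf fun s hs =>
      hM s ⟨(hpnn i hi.le).trans hs.1, hs.2.trans (hpt (i + 1) hi)⟩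
  let S : ℝ → ℝ := fun s =>
    ∑ j ∈ Finset.range r, (Icc (u j) (u j + ε)).indicator (fun _ => (1 : ℝ)) s
  have hSi : ∀ a b, IntervalIntegrable S volume a b := fun a b => by
    simpa [S, Finset.sum_fn] using IntervalIntegrable.sum (Finset.range r) fun j _ =>
      intervalIntegrable_indicator_Icc_one (u j) (u j + ε) a b
  have hgi : ∀ a b, IntervalIntegrable (fun s => η + 2 * M * S s) volume a b := fun a b =>
    intervalIntegrable_const.add ((hSi a b).const_mul _)
  have hpiece : ∀ i ∈ Finset.range K,
      |f (p i) * (p (i + 1) - p i) - ∫ s in p i..p (i + 1), f s|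
        ≤ ∫ s in p i..p (i + 1), (η + 2 * M * S s) := fun i hi => by
    have hi' := Finset.mem_range.mp hi
    have heq : f (p i) * (p (i + 1) - p i) - ∫ s in p i..p (i + 1), f s
        = ∫ s in p i..p (i + 1), (f (p i) - f s) := by
      rw [intervalIntegral.integral_sub intervalIntegrable_const (hfi i hi'),
        intervalIntegral.integral_const, smul_eq_mul, mul_comm]
    rw [heq, ← Real.norm_eq_abs]
    refine intervalIntegral.norm_integral_le_of_norm_le (hp i hi').le ?_ (hgi _ _)
    filter_upwards [(countable_singleton t).ae_notMem volume] with s hst hs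
    exact abs_sub_le_add_sum_indicator hη hM hu0 hur hosc (hpnn i hi'.le) hs.1.le
      (by linarith [hs.2, hmesh i hi']) (lt_of_le_of_ne (hs.2.trans (hpt (i + 1) hi')) hst)
  have hS : ∫ s in (0 : ℝ)..t, S s ≤ r * ε := by
    rw [intervalIntegral.integral_finsetSum fun j _ =>
      intervalIntegrable_indicator_Icc_one (u j) (u j + ε) 0 t]
    simpa using Finset.sum_le_card_nsmul (Finset.range r) _ ε fun j _ =>
      integral_indicator_Icc_one_le (a := u j) ht hε
  have hsum := intervalIntegral.sum_integral_adjacent_intervals hfi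
  have hgsum := intervalIntegral.sum_integral_adjacent_intervals
    (n := K) (a := p) fun i _ => hgi (p i) (p (i + 1))
  rw [hp0, hpK] at hsum hgsum
  calc |∑ i ∈ Finset.range K, f (p i) * (p (i + 1) - p i) - ∫ s in (0 : ℝ)..t, f s|
      = |∑ i ∈ Finset.range K,
          (f (p i) * (p (i + 1) - p i) - ∫ s in p i..p (i + 1), f s)| := by
        rw [Finset.sum_sub_distrib, hsum]
    _ ≤ ∑ i ∈ Finset.range K, ∫ s in p i..p (i + 1), (η + 2 * M * S s) :=
        (Finset.abs_sum_le_sum_abs _ _).trans (Finset.sum_le_sum hpiece)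
    _ = η * t + 2 * M * ∫ s in (0 : ℝ)..t, S s := by
        rw [hgsum, intervalIntegral.integral_add intervalIntegrable_const ((hSi 0 t).const_mul _),
          intervalIntegral.integral_const, intervalIntegral.integral_const_mul, smul_eq_mul,
          sub_zero, mul_comm t]
    _ ≤ η * t + 2 * M * (r * ε) := by gcongr

/-- a Riemann-sum convergence lemma. If `xₙ` are uniformly bounded
measurable functions on `[0,t]` whose integrals converge to that of `x`, with uniform
control of the càdlàg modulus `w′(xₙ; δ, t)`, and if left-endpoint Riemann sums are
taken along partitions of `[0,t]` with vanishing mesh, then the Riemann sums converge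
to `∫_0^t x(s) ds`. -/
theorem stmt15 (t : ℝ) (ht : 0 < t)
    (x : ℝ → ℝ) (hxm : Measurable x) (hxb : ∃ M : ℝ, ∀ s ∈ Set.Icc (0:ℝ) t, |x s| ≤ M)
    (xn : ℕ → ℝ → ℝ) (hxnm : ∀ n, Measurable (xn n))
    (hbd : ∃ M : ℝ, ∀ n, ∀ s ∈ Set.Icc (0:ℝ) t, |xn n s| ≤ M)
    (hint : Tendsto (fun n => ∫ s in (0:ℝ)..t, xn n s) atTop
      (nhds (∫ s in (0:ℝ)..t, x s)))
    (hosc : ∀ η : ℝ, 0 < η → ∃ δ : ℝ, 0 < δ ∧ ∀ n : ℕ, ∃ (r : ℕ) (u : ℕ → ℝ),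
      1 ≤ r ∧ u 0 = 0 ∧ u r = t ∧ (∀ i, i < r → u i < u (i + 1)) ∧
      (∀ i, i + 1 < r → δ ≤ u (i + 1) - u i) ∧
      (∀ i, i < r → ∀ s ∈ Set.Ico (u i) (u (i + 1)), ∀ v ∈ Set.Ico (u i) (u (i + 1)),
        |xn n s - xn n v| ≤ η))
    (K : ℕ → ℕ) (hK : ∀ n, 1 ≤ K n)
    (p : ℕ → ℕ → ℝ) (hp0 : ∀ n, p n 0 = 0) (hpK : ∀ n, p n (K n) = t)
    (hpmono : ∀ n, ∀ i, i < K n → p n i < p n (i + 1))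
    (hmesh : ∀ ε : ℝ, 0 < ε → ∃ N : ℕ, ∀ n, N ≤ n → ∀ i, i < K n →
      p n (i + 1) - p n i ≤ ε) :
    Tendsto (fun n => ∑ i ∈ Finset.range (K n), xn n (p n i) * (p n (i + 1) - p n i))
      atTop (nhds (∫ s in (0:ℝ)..t, x s)) := by
  obtain ⟨M, hM⟩ := hbd
  have hM0 : 0 ≤ M := (abs_nonneg _).trans (hM 0 0 ⟨le_rfl, ht.le⟩)
  refine (tendsto_iff_of_dist (Metric.tendsto_atTop.mpr fun e he => ?_)).mp hint
  obtain ⟨δ, hδ, hu⟩ := hosc (e / (2 * t)) (by positivity)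
  have hR : 0 < t / δ + 1 := by positivity
  set ε := e / (4 * (M + 1) * (t / δ + 1)) with hε
  have hε0 : 0 < ε := by positivity
  obtain ⟨N, hN⟩ := hmesh ε hε0
  refine ⟨N, fun n hn => ?_⟩
  obtain ⟨r, u, hr, hu0, hur, humono, hgap, hosc'⟩ := hu n
  have hrle : (r : ℝ) ≤ t / δ + 1 := by
    obtain ⟨k, rfl⟩ := Nat.exists_eq_add_of_le' hr
    have hk : k * δ ≤ u k - u 0 := natCast_mul_le_sub_of_le_gap fun i hi => hgap i (by omega)
    have : (k : ℝ) ≤ t / δ := by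
      rw [le_div_iff₀ hδ]
      linarith [humono k (Nat.lt_succ_self k)]
    push_cast
    linarith
  have herr := abs_riemannSum_sub_integral_le_s15 ht.le (hxnm n) (by positivity) hε0.le (hM n) hu0 hur
    hosc' (hp0 n) (hpK n) (hpmono n) (hN n hn)
  rw [Real.dist_eq, sub_zero, abs_of_nonneg dist_nonneg, dist_comm, Real.dist_eq]
  refine herr.trans_lt ?_
  have h1 : e / (2 * t) * t = e / 2 := by field_simp
  have h2 : 2 * (M + 1) * ((t / δ + 1) * ε) = e / 2 := by
    rw [hε]
    field_simp
    norm_num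
  have h3 : 2 * M * (r * ε) ≤ 2 * M * ((t / δ + 1) * ε) := by gcongr
  have h4 : 0 < (t / δ + 1) * ε := by positivity
  linarith
end
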